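/- arXiv:2010.04982 — 3 statements merged into one kernel-verified Lean document; each statement's English description precedes it below -/
import Mathlib

section
/- There is an absolute constant K > 0 such that the following holds: if M = Ap with p a sufficiently large prime, gcd(A,p) = 1, and A ≤ 0.1·p^{0.1}, then |S(R_M) − 0.25·g_A(1/2)·p| ≤ K·A³·p^{0.95}. -/
open Finset

/-- The set of quadratic residues modulo `M`, as a finset of `ZMod M`. -/
def QR (M : ℕ) : Finset (ZMod M) := (Finset.range M).image (fun a : ℕ => ((a : ZMod M)) ^ 2)

/-- The cyclic gap from `u` to the next element of `U`: the least `k ≥ 1` with `u + k ∈ U`. -/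
noncomputable def cycGap (M : ℕ) (U : Finset (ZMod M)) (u : ZMod M) : ℕ :=
  sInf {k : ℕ | 0 < k ∧ u + (k : ZMod M) ∈ U}

/-- The stochasticity parameter `S(U)`: the sum of the squares of the consecutive
(cyclic) distances between elements of `U`. -/
noncomputable def stoch (M : ℕ) (U : Finset (ZMod M)) : ℕ :=
  ∑ u ∈ U, (cycGap M U u) ^ 2

/-- The increasing list `0 = r_1 < r_2 < ... < r_{|R_A|}` of quadratic residues mod `A`
(with representatives in `{0, ..., A-1}`). -/
def resList (A : ℕ) : List ℕ := ((QR A).image ZMod.val).sort (· ≤ ·)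

/-- The cyclic consecutive distances `s_1, ..., s_{|R_A|}` between quadratic residues mod `A`,
indexed from `0`, with indices taken modulo `|R_A|`. -/
def gapSeq (A : ℕ) (i : ℕ) : ℕ :=
  let l := resList A
  let n := l.length
  (l.getD ((i + 1) % n) 0 + A - l.getD (i % n) 0) % A

/-- The coefficients `β_k` of the polynomial `F_A`:
`β_0 = β_{|R_A|} = Σ_i s_i²` and `β_k = 2 Σ_i s_i s_{i+k}` for `0 < k < |R_A|`. -/
def betaCoef (A k : ℕ) : ℕ :=
  if k = 0 ∨ k = (QR A).card then ∑ i ∈ Finset.range (QR A).card, (gapSeq A i) ^ 2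
  else 2 * ∑ i ∈ Finset.range (QR A).card, gapSeq A i * gapSeq A (i + k)

/-- `F_A(y) = Σ_{k=0}^{|R_A|} β_k y^k`. -/
noncomputable def FA (A : ℕ) (y : ℝ) : ℝ :=
  ∑ k ∈ Finset.range ((QR A).card + 1), (betaCoef A k : ℝ) * y ^ k

/-- `Q_A(y) = 1 + y + ... + y^(|R_A| - 1)`. -/
noncomputable def QA (A : ℕ) (y : ℝ) : ℝ :=
  ∑ k ∈ Finset.range (QR A).card, y ^ k

/-- `f_A(y) = F_A(y) / Q_A(y)`. -/
noncomputable def fA (A : ℕ) (y : ℝ) : ℝ := FA A y / QA A y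

/-- `r(i,j) = #({i+1, ..., i+j-1} (mod A) ∩ R_A)`, with the convention `r(i,1) = 0`. -/
def rij (A : ℕ) (i : ZMod A) (j : ℕ) : ℕ :=
  ((Finset.Ico 1 j).filter (fun ν : ℕ => i + (ν : ZMod A) ∈ QR A)).card

/-- `g_A(y) = Σ_(j=1)^A Σ_(i ∈ R_A ∩ (R_A - j)) y^(r(i,j)) Σ_(k ≥ 0) y^(|R_A| k) (Ak + j)²`. -/
noncomputable def gA (A : ℕ) (y : ℝ) : ℝ :=
  ∑ j ∈ Finset.Icc 1 A, ∑ i ∈ (QR A).filter (fun i => i + (j : ZMod A) ∈ QR A),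
    y ^ (rij A i j) * ∑' k : ℕ, y ^ ((QR A).card * k) * ((A : ℝ) * k + j) ^ 2

open Polynomial in
lemma eq_zero_of_X_pow_dvd_add_mul_pow {p : ℕ} [Fact p.Prime] (hp : p ≠ 2) {f r s : (ZMod p)[X]}
    (hf : ∀ a b : (ZMod p)[X], a ^ 2 * f = b ^ 2 * C (f.coeff 0) → a = 0 ∧ b = 0)
    (hr : 2 * r.natDegree + f.natDegree < p) (hs : 2 * s.natDegree + f.natDegree < p)
    (h : (X : (ZMod p)[X]) ^ p ∣ r + s * f ^ (p / 2)) : r = 0 ∧ s = 0 := by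
  apply hf
  have hodd : 2 * (p / 2) + 1 = p := by
    have := (Fact.out : p.Prime).eq_two_or_odd
    omega
  have h1 : (X : (ZMod p)[X]) ^ p ∣ r ^ 2 * f - s ^ 2 * f ^ p := by
    have : r ^ 2 * f - s ^ 2 * f ^ p = (r + s * f ^ (p / 2)) * ((r - s * f ^ (p / 2)) * f) := by
      have e : f ^ p = f ^ (p / 2) * f ^ (p / 2) * f := by
        rw [← pow_add, ← pow_succ]
        congr 1
        omega
      rw [e]; ring
    rw [this]
    exact Dvd.dvd.mul_right h _
  have h2 : (X : (ZMod p)[X]) ^ p ∣ f ^ p - C (f.coeff 0) := by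
    have h3 : (X : (ZMod p)[X]) ∣ f - C (f.coeff 0) := by
      rw [X_dvd_iff]; simp
    have h4 := map_dvd (expand (ZMod p) p) h3
    simpa only [map_sub, expand_X, expand_C, ZMod.expand_card] using h4
  have h5 : (X : (ZMod p)[X]) ^ p ∣ r ^ 2 * f - s ^ 2 * C (f.coeff 0) := by
    have : r ^ 2 * f - s ^ 2 * C (f.coeff 0) =
        (r ^ 2 * f - s ^ 2 * f ^ p) + s ^ 2 * (f ^ p - C (f.coeff 0)) := by ring
    rw [this]
    exact dvd_add h1 (Dvd.dvd.mul_left h2 _)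
  refine sub_eq_zero.mp (eq_zero_of_dvd_of_natDegree_lt h5 ?_)
  rw [natDegree_X_pow]
  refine (natDegree_sub_le _ _).trans_lt (max_lt ?_ ?_)
  · refine natDegree_mul_le.trans_lt ?_
    have := natDegree_pow_le (p := r) (n := 2)
    omega
  · refine natDegree_mul_le.trans_lt ?_
    have := natDegree_pow_le (p := s) (n := 2)
    simp only [natDegree_C]
    omega

open Polynomial in
lemma eq_zero_of_sum_X_pow_mul_eq_zero {p : ℕ} [Fact p.Prime] (hp : p ≠ 2) {f : (ZMod p)[X]}
    (hf : ∀ a b : (ZMod p)[X], a ^ 2 * f = b ^ 2 * C (f.coeff 0) → a = 0 ∧ b = 0)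
    (J : ℕ) (r s : ℕ → (ZMod p)[X])
    (hr : ∀ j, 2 * (r j).natDegree + f.natDegree < p)
    (hs : ∀ j, 2 * (s j).natDegree + f.natDegree < p)
    (h : ∑ j ∈ Finset.range J, X ^ (p * j) * (r j + s j * f ^ (p / 2)) = 0) :
    ∀ j < J, r j = 0 ∧ s j = 0 := by
  induction J generalizing r s with
  | zero => simp
  | succ J ih =>
    rw [Finset.sum_range_succ'] at h
    have e : ∑ j ∈ Finset.range J, (X : (ZMod p)[X]) ^ (p * (j + 1)) *
        (r (j + 1) + s (j + 1) * f ^ (p / 2)) = X ^ p * ∑ j ∈ Finset.range J,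
          X ^ (p * j) * (r (j + 1) + s (j + 1) * f ^ (p / 2)) := by
      rw [Finset.mul_sum]
      refine Finset.sum_congr rfl fun j _ => ?_
      ring
    rw [e, mul_zero, pow_zero, one_mul] at h
    have h0 : r 0 = 0 ∧ s 0 = 0 := by
      refine eq_zero_of_X_pow_dvd_add_mul_pow hp hf (hr 0) (hs 0) ?_
      rw [eq_neg_of_add_eq_zero_right h]
      exact (Dvd.intro _ rfl).neg_right
    rw [h0.1, h0.2, zero_mul, add_zero, add_zero] at h
    have h1 := (mul_eq_zero.mp h).resolve_left (pow_ne_zero _ X_ne_zero)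
    have h2 := ih (fun j => r (j + 1)) (fun j => s (j + 1)) (fun j => hr _) (fun j => hs _) h1
    intro j hj
    cases j with
    | zero => exact h0
    | succ j => exact h2 j (by omega)

open Polynomial in
/-- The linear map `r ↦ f r' + c f' r`, through which `derivative` acts on `f ^ c * r`. -/
noncomputable def twistedDerivative {F : Type*} [Field F] (f : F[X]) (c : F) : F[X] →ₗ[F] F[X] :=
  (LinearMap.mulLeft F f) ∘ₗ derivative + c • LinearMap.mulLeft F (derivative f)

open Polynomial in
/-- The cofactor of `f ^ (e - k)` in the `k`-th derivative of `f ^ e * r`. -/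
noncomputable def iterTwistedDerivative {F : Type*} [Field F] (f : F[X]) (e : ℕ) :
    ℕ → F[X] →ₗ[F] F[X]
  | 0 => LinearMap.id
  | k + 1 => twistedDerivative f ((e - k : ℕ) : F) ∘ₗ iterTwistedDerivative f e k

open Polynomial in
lemma iterate_derivative_pow_mul {F : Type*} [Field F] (f r : F[X]) (e k : ℕ) (hk : k ≤ e) :
    derivative^[k] (f ^ e * r) = f ^ (e - k) * iterTwistedDerivative f e k r := by
  induction k with
  | zero => simp [iterTwistedDerivative]
  | succ k ih =>
    rw [Function.iterate_succ_apply', ih (by omega)]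
    obtain ⟨n, hn⟩ : ∃ n, e - k = n + 1 := ⟨e - k - 1, by omega⟩
    have hn' : e - (k + 1) = n := by omega
    simp only [iterTwistedDerivative, twistedDerivative, hn, hn', LinearMap.comp_apply,
      LinearMap.add_apply, LinearMap.smul_apply, LinearMap.mulLeft_apply, derivative_mul,
      derivative_pow, smul_eq_C_mul]
    simp only [Nat.add_sub_cancel]
    ring

open Polynomial in
lemma natDegree_iterTwistedDerivative_le {F : Type*} [Field F] (f r : F[X]) (e k : ℕ) :
    (iterTwistedDerivative f e k r).natDegree ≤ r.natDegree + k * f.natDegree := by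
  induction k with
  | zero => simp [iterTwistedDerivative]
  | succ k ih =>
    simp only [iterTwistedDerivative, twistedDerivative, LinearMap.comp_apply,
      LinearMap.add_apply, LinearMap.smul_apply, LinearMap.mulLeft_apply]
    set q := iterTwistedDerivative f e k r
    have h1 := natDegree_derivative_le q
    have h2 := natDegree_derivative_le f
    refine (natDegree_add_le _ _).trans (max_le ?_ ((natDegree_smul_le _ _).trans ?_))
    · refine natDegree_mul_le.trans ?_
      rw [add_mul]; omega
    · refine natDegree_mul_le.trans ?_
      rw [add_mul]; omega

open Polynomial in
lemma iterate_derivative_X_pow_char_mul {p : ℕ} (q : (ZMod p)[X]) (j k : ℕ) :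
    derivative^[k] (X ^ (p * j) * q) = X ^ (p * j) * derivative^[k] q := by
  induction k with
  | zero => simp
  | succ k ih =>
    rw [Function.iterate_succ_apply', ih, Function.iterate_succ_apply', derivative_mul]
    simp [derivative_X_pow]

open Polynomial in
lemma exists_stepanov_coefficients {F : Type*} [Field F] (f : F[X]) (m J l h : ℕ) (c : F)
    (hm : 0 < m) (hdim : l * (m + l * f.natDegree + J) < 2 * m * J) :
    ∃ r s : ℕ → F[X], (∀ j, (r j).natDegree < m) ∧ (∀ j, (s j).natDegree < m) ∧
      (∃ j < J, ¬ (r j = 0 ∧ s j = 0)) ∧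
      ∀ k < l, ∑ j ∈ Finset.range J, X ^ j * (iterTwistedDerivative f l k (r j) +
        c • iterTwistedDerivative f (l + h) k (s j)) = 0 := by
  let V := Fin J → (degreeLT F m × degreeLT F m)
  let n := m + l * f.natDegree + J
  let Q : ℕ → V →ₗ[F] F[X] := fun k => ∑ j : Fin J,
    (LinearMap.mulLeft F (X ^ (j : ℕ))) ∘ₗ
      (iterTwistedDerivative f l k ∘ₗ (degreeLT F m).subtype ∘ₗ LinearMap.fst F _ _ ∘ₗ
          LinearMap.proj j +
        c • iterTwistedDerivative f (l + h) k ∘ₗ (degreeLT F m).subtype ∘ₗ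
          LinearMap.snd F _ _ ∘ₗ LinearMap.proj j)
  let T : V →ₗ[F] (Fin l → Fin n → F) :=
    LinearMap.pi fun k => LinearMap.pi fun i => lcoeff F (i : ℕ) ∘ₗ Q (k : ℕ)
  have hfd : FiniteDimensional F (degreeLT F m) :=
    Module.Finite.equiv (degreeLTEquiv F m).symm
  have hfr : Module.finrank F (degreeLT F m) = m := by
    rw [(degreeLTEquiv F m).finrank_eq]; simp
  have hlt : Module.finrank F (Fin l → Fin n → F) < Module.finrank F V := by
    simp only [V, Module.finrank_pi_fintype, Module.finrank_prod, hfr]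
    simp only [Finset.sum_const, Finset.card_univ, Fintype.card_fin, smul_eq_mul,
      Module.finrank_self, mul_one]
    calc l * n < 2 * m * J := hdim
      _ = J * (m + m) := by ring
  obtain ⟨v, hv, hv0⟩ := (Submodule.ne_bot_iff _).mp (LinearMap.ker_ne_bot_of_finrank_lt hlt (f := T))
  have hdeg : ∀ q : degreeLT F m, (q : F[X]).natDegree < m := fun q => by
    have hq := mem_degreeLT.mp q.2
    by_cases h0 : (q : F[X]) = 0
    · rw [h0]; simpa using hm
    · exact (natDegree_lt_iff_degree_lt h0).mpr hq
  refine ⟨fun j => if hj : j < J then ((v ⟨j, hj⟩).1 : F[X]) else 0,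
    fun j => if hj : j < J then ((v ⟨j, hj⟩).2 : F[X]) else 0, ?_, ?_, ?_, ?_⟩
  · intro j
    by_cases hj : j < J
    · simp only [hj, dif_pos]; exact hdeg _
    · simpa [hj] using hm
  · intro j
    by_cases hj : j < J
    · simp only [hj, dif_pos]; exact hdeg _
    · simpa [hj] using hm
  · by_contra! hcon
    apply hv0
    funext j
    have := hcon j j.2
    simp only [j.2, dif_pos] at this
    exact Prod.ext (Subtype.ext this.1) (Subtype.ext this.2)
  · intro k hk
    rw [Finset.sum_range]
    simp only [Fin.is_lt, dif_pos, Fin.eta]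
    have hQ : Q k v = ∑ j : Fin J, X ^ (j : ℕ) *
        (iterTwistedDerivative f l k ((v j).1 : F[X]) +
          c • iterTwistedDerivative f (l + h) k ((v j).2 : F[X])) := by
      simp only [Q, LinearMap.sum_apply]
      rfl
    rw [← hQ]
    have hnd : (Q k v).degree < n := by
      rw [hQ]
      refine (degree_sum_le _ _).trans_lt ((Finset.sup_lt_iff (WithBot.bot_lt_coe n)).mpr ?_)
      intro j _
      refine degree_le_natDegree.trans_lt (Nat.cast_lt.mpr ?_)
      refine natDegree_mul_le.trans_lt ?_
      rw [natDegree_X_pow]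
      have hk' : k * f.natDegree ≤ l * f.natDegree := Nat.mul_le_mul_right _ hk.le
      have h1 := natDegree_iterTwistedDerivative_le f ((v j).1 : F[X]) l k
      have h2 := natDegree_iterTwistedDerivative_le f ((v j).2 : F[X]) (l + h) k
      have h3 := hdeg (v j).1
      have h4 := hdeg (v j).2
      have h5 : (iterTwistedDerivative f l k ((v j).1 : F[X]) +
          c • iterTwistedDerivative f (l + h) k ((v j).2 : F[X])).natDegree <
            m + l * f.natDegree :=
        (natDegree_add_le _ _).trans_lt (max_lt (by omega)
          ((natDegree_smul_le _ _).trans_lt (by omega)))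
      have := j.2
      change (j : ℕ) + _ < m + l * f.natDegree + J
      omega
    ext i
    rw [coeff_zero]
    by_cases hi : i < n
    · have := congrFun (congrFun (LinearMap.mem_ker.mp hv) ⟨k, hk⟩) ⟨i, hi⟩
      simpa [T] using this
    · exact coeff_eq_zero_of_degree_lt (hnd.trans_le (by exact_mod_cast not_lt.mp hi))

open Polynomial in
/-- Stepanov's method: bound for the number of points where `f ^ (p / 2)` takes the value `c`. -/
lemma stepanov_bound {p : ℕ} [Fact p.Prime] (hp : p ≠ 2) {f : (ZMod p)[X]} (hf0 : f ≠ 0)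
    (hf : ∀ a b : (ZMod p)[X], a ^ 2 * f = b ^ 2 * C (f.coeff 0) → a = 0 ∧ b = 0)
    (m J l : ℕ) (c : ZMod p) (hm : 0 < m) (hmp : 2 * m + f.natDegree ≤ p) (hl : 0 < l)
    (hlp : l ≤ p)
    (hdim : l * (m + l * f.natDegree + J) < 2 * m * J) (Z : Finset (ZMod p))
    (hZ : ∀ x ∈ Z, f.eval x ^ (p / 2) = c) :
    l * Z.card ≤ l * f.natDegree + m + f.natDegree * (p / 2) + p * (J - 1) := by
  obtain ⟨r, s, hr, hs, ⟨j₀, hj₀, hne⟩, hQ⟩ :=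
    exists_stepanov_coefficients f m J l (p / 2) c hm hdim
  set P : (ZMod p)[X] := f ^ l * ∑ j ∈ Finset.range J, X ^ (p * j) * (r j + s j * f ^ (p / 2))
    with hP
  have hP0 : P ≠ 0 := by
    refine mul_ne_zero (pow_ne_zero _ hf0) fun h => hne ?_
    refine eq_zero_of_sum_X_pow_mul_eq_zero hp hf J r s (fun j => ?_) (fun j => ?_) h j₀ hj₀
    · have := hr j; omega
    · have := hs j; omega
  have hP' : P = ∑ j ∈ Finset.range J,
      (X ^ (p * j) * (f ^ l * r j) + X ^ (p * j) * (f ^ (l + p / 2) * s j)) := by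
    rw [hP, Finset.mul_sum]
    refine Finset.sum_congr rfl fun j _ => ?_
    ring
  have hroot : ∀ x ∈ Z, ∀ k ≤ l - 1, (derivative^[k] P).IsRoot x := by
    intro x hx k hk
    have hxp : ∀ j, x ^ (p * j) = x ^ j := fun j => by rw [pow_mul, ZMod.pow_card]
    have h1 := congrArg (eval x) (hQ k (by omega))
    simp only [eval_finsetSum, eval_mul, eval_add, eval_pow, eval_X, eval_smul, eval_zero,
      smul_eq_mul] at h1
    rw [IsRoot.def, hP', iterate_derivative_sum, eval_finsetSum,
      ← mul_zero (eval x f ^ (l - k)), ← h1, Finset.mul_sum]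
    refine Finset.sum_congr rfl fun j _ => ?_
    rw [iterate_map_add, iterate_derivative_X_pow_char_mul,
      iterate_derivative_X_pow_char_mul, iterate_derivative_pow_mul _ _ _ _ (by omega),
      iterate_derivative_pow_mul _ _ _ _ (by omega)]
    simp only [eval_mul, eval_add, eval_pow, eval_X, hxp]
    rw [show l + p / 2 - k = (l - k) + p / 2 by omega, pow_add, hZ x hx]
    ring
  have hmult : ∀ x ∈ Z, l ≤ P.rootMultiplicity x := by
    intro x hx
    have := lt_rootMultiplicity_of_isRoot_iterate_derivative_of_mem_nonZeroDivisors hP0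
      (hroot x hx) (by
        refine mem_nonZeroDivisors_of_ne_zero ?_
        rw [Ne, ZMod.natCast_eq_zero_iff, (Fact.out : p.Prime).dvd_factorial]
        omega)
    omega
  have hcard : l * Z.card ≤ P.natDegree := by
    calc l * Z.card = ∑ x ∈ Z, l := by simp [mul_comm]
      _ ≤ ∑ x ∈ Z, P.roots.count x := Finset.sum_le_sum fun x hx => by
          rw [count_roots]; exact hmult x hx
      _ ≤ P.roots.card := by
          rw [← Multiset.toFinset_sum_count_eq]
          have : ∑ x ∈ Z, P.roots.count x = ∑ x ∈ Z ∩ P.roots.toFinset, P.roots.count x := by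
            refine (Finset.sum_subset Finset.inter_subset_left fun x hx hx' => ?_).symm
            rw [Multiset.count_eq_zero]
            intro hmem
            exact hx' (Finset.mem_inter.mpr ⟨hx, Multiset.mem_toFinset.mpr hmem⟩)
          rw [this]
          exact Finset.sum_le_sum_of_subset Finset.inter_subset_right
      _ ≤ P.natDegree := card_roots' P
  refine hcard.trans (natDegree_mul_le.trans ?_)
  rw [add_assoc, add_assoc]
  refine Nat.add_le_add natDegree_pow_le ?_
  refine natDegree_sum_le_of_forall_le _ _ fun j hj => ?_
  refine natDegree_mul_le.trans ?_
  rw [natDegree_X_pow]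
  have h1 : (r j + s j * f ^ (p / 2)).natDegree ≤ m + f.natDegree * (p / 2) := by
    refine (natDegree_add_le _ _).trans (max_le ?_ (natDegree_mul_le.trans ?_))
    · have := hr j; omega
    · have := hs j
      have h2 := natDegree_pow_le (p := f) (n := p / 2)
      rw [mul_comm] at h2
      omega
  have h3 : p * j ≤ p * (J - 1) :=
    Nat.mul_le_mul_left _ (by have := Finset.mem_range.mp hj; omega)
  omega

lemma stepanov_numeric_bound {p d N m : ℕ} (hd : 0 < d) (hm : m = (p - d) / 2)
    (hpd : 21 * d < Real.sqrt p)
    (h : 2 * Nat.sqrt p * N ≤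
      2 * Nat.sqrt p * d + m + d * (p / 2) + p * (Nat.sqrt p + 16 * d - 1)) :
    (N : ℝ) ≤ p / 2 + 10 * d * Real.sqrt p := by
  set q := Nat.sqrt p with hq
  have hs : Real.sqrt p * Real.sqrt p = p := Real.mul_self_sqrt (Nat.cast_nonneg p)
  have hq1 : Real.sqrt p < q + 1 := by
    rw [Real.sqrt_lt' (by positivity)]
    have := Nat.lt_succ_sqrt p
    rw [← hq] at this
    have h2 : (p : ℝ) < ((q.succ * q.succ : ℕ) : ℝ) := by exact_mod_cast this
    push_cast at h2
    nlinarith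
  have hd1 : (1 : ℝ) ≤ d := by exact_mod_cast hd
  have h2 : 2 * (q : ℝ) * N ≤ 2 * q * d + p * q + 17 * p * d := by
    have h1 : 2 * q * N ≤ 2 * q * d + p * q + 17 * p * d := by
      have e1 : p * (q + 16 * d - 1) + p = p * (q + 16 * d) := by
        rw [← Nat.mul_succ]; congr 1; omega
      have e2 : d * (p / 2) ≤ d * p := Nat.mul_le_mul_left _ (Nat.div_le_self _ _)
      have e3 : m ≤ p := by omega
      nlinarith
    exact_mod_cast h1
  set t := Real.sqrt p
  have hqpos : (20 : ℝ) < q := by linarith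
  have h3 : 17 * t ≤ 18 * q := by linarith
  have h4 : 2 * (q : ℝ) * N ≤ 2 * q * (p / 2 + 10 * d * t) := by
    rw [← hs] at h2 ⊢
    have h5 : 17 * (t * t) * d ≤ 18 * q * t * d := by
      have : 0 ≤ t * d := by positivity
      nlinarith
    have h6 : 2 * q * d ≤ 2 * q * (d * t) := by
      have : (d : ℝ) ≤ d * t := by nlinarith
      nlinarith
    nlinarith
  exact le_of_mul_le_mul_left h4 (by positivity)

lemma two_mul_sq_condition {p d m : ℕ} (hd : 0 < d) (hm : m = (p - d) / 2)
    (hpd : 21 * d < Real.sqrt p) :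
    2 * Nat.sqrt p * (m + 2 * Nat.sqrt p * d + (Nat.sqrt p + 16 * d)) <
      2 * m * (Nat.sqrt p + 16 * d) := by
  have h21 : 21 * d ≤ Nat.sqrt p := by
    have : ((21 * d : ℕ) : ℝ) < Real.sqrt p := by exact_mod_cast hpd
    rw [Real.lt_sqrt (by positivity)] at this
    rw [Nat.le_sqrt']
    exact_mod_cast this.le
  have hqp := Nat.sqrt_le p
  set q := Nat.sqrt p
  have h1 : 21 * q ≤ p := by nlinarith
  have h2 : p ≤ 4 * m := by omega
  have h3 : p * d ≤ 4 * m * d := Nat.mul_le_mul_right _ h2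
  have h4 : 21 * q * d ≤ p * d := Nat.mul_le_mul_right _ h1
  have h5 : q * q * d ≤ p * d := Nat.mul_le_mul_right _ hqp
  have h6 : q * q ≤ q * q * d := Nat.le_mul_of_pos_right _ hd
  have h7 : 0 < q * d := by
    have : 0 < q := by omega
    positivity
  nlinarith

open Polynomial in
/-- The Weil bound (with a worse constant) for sums of the quadratic character. -/
lemma abs_sum_quadraticChar_eval_le {p : ℕ} [Fact p.Prime] (hp : p ≠ 2) {f : (ZMod p)[X]}
    (hd : 0 < f.natDegree)
    (hf : ∀ a b : (ZMod p)[X], a ^ 2 * f = b ^ 2 * C (f.coeff 0) → a = 0 ∧ b = 0) :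
    |((∑ x : ZMod p, quadraticChar (ZMod p) (f.eval x) : ℤ) : ℝ)| ≤
      21 * f.natDegree * Real.sqrt p := by
  have hs : Real.sqrt p * Real.sqrt p = p := Real.mul_self_sqrt (Nat.cast_nonneg p)
  have hf0 : f ≠ 0 := by
    rintro rfl
    simp at hd
  by_cases hpd : 21 * f.natDegree < Real.sqrt p
  swap
  · calc |((∑ x : ZMod p, quadraticChar (ZMod p) (f.eval x) : ℤ) : ℝ)|
        ≤ ∑ x : ZMod p, |((quadraticChar (ZMod p) (f.eval x) : ℤ) : ℝ)| := by
          rw [Int.cast_sum]; exact Finset.abs_sum_le_sum_abs _ _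
      _ ≤ ∑ _x : ZMod p, (1 : ℝ) := by
          refine Finset.sum_le_sum fun x _ => ?_
          by_cases h0 : f.eval x = 0
          · simp [h0]
          · rcases quadraticChar_dichotomy h0 with h | h <;> simp [h]
      _ = p := by simp [ZMod.card]
      _ ≤ _ := by
          have := Real.sqrt_nonneg p
          nlinarith
  set d := f.natDegree with hdd
  have key : ∀ c : ZMod p,
      ((Finset.univ.filter fun x : ZMod p => f.eval x ^ (p / 2) = c).card : ℝ) ≤
        p / 2 + 10 * d * Real.sqrt p := by
    intro c
    have h21 : 21 * d ≤ Nat.sqrt p := by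
      have : ((21 * d : ℕ) : ℝ) < Real.sqrt p := by exact_mod_cast hpd
      rw [Real.lt_sqrt (by positivity)] at this
      rw [Nat.le_sqrt']
      exact_mod_cast this.le
    have hqp := Nat.sqrt_le p
    have h2 : 21 * Nat.sqrt p ≤ p := by nlinarith
    refine stepanov_numeric_bound hd rfl hpd ?_
    exact stepanov_bound hp hf0 hf ((p - d) / 2) (Nat.sqrt p + 16 * d) (2 * Nat.sqrt p) c
      (by omega) (by omega) (by omega) (by omega) (two_mul_sq_condition hd rfl hpd) _
      (fun x hx => (Finset.mem_filter.mp hx).2)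
  have hring : ringChar (ZMod p) ≠ 2 := by rwa [ZMod.ringChar_zmod_n]
  have hval : ∀ x : ZMod p, ((quadraticChar (ZMod p) (f.eval x) : ℤ) : ZMod p) =
      f.eval x ^ (p / 2) := fun x => by
    rw [quadraticChar_eq_pow_of_char_ne_two' hring, ZMod.card]
  have hcard : ∀ e : ℤ, ((Finset.univ.filter fun x : ZMod p =>
      quadraticChar (ZMod p) (f.eval x) = e).card : ℝ) ≤ p / 2 + 10 * d * Real.sqrt p := by
    intro e
    refine le_trans ?_ (key (e : ZMod p))
    refine Nat.cast_le.mpr (Finset.card_le_card fun x hx => ?_)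
    rw [Finset.mem_filter] at hx ⊢
    exact ⟨hx.1, by rw [← hval, hx.2]⟩
  have hzero : ((Finset.univ.filter fun x : ZMod p =>
      quadraticChar (ZMod p) (f.eval x) = 0).card : ℝ) ≤ d := by
    refine Nat.cast_le.mpr ?_
    refine le_trans (Finset.card_le_card fun x hx => ?_)
      ((Multiset.toFinset_card_le f.roots).trans (card_roots' f))
    rw [Finset.mem_filter, quadraticChar_eq_zero_iff] at hx
    rw [Multiset.mem_toFinset, mem_roots hf0]
    exact hx.2
  set S1 := Finset.univ.filter fun x : ZMod p => quadraticChar (ZMod p) (f.eval x) = 1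
  set S2 := Finset.univ.filter fun x : ZMod p => quadraticChar (ZMod p) (f.eval x) = -1
  set S0 := Finset.univ.filter fun x : ZMod p => quadraticChar (ZMod p) (f.eval x) = 0
  have hsum : ∑ x : ZMod p, quadraticChar (ZMod p) (f.eval x) = (S1.card : ℤ) - S2.card := by
    simp only [S1, S2, Finset.card_filter, Nat.cast_sum, ← Finset.sum_sub_distrib]
    refine Finset.sum_congr rfl fun x _ => ?_
    by_cases h0 : f.eval x = 0
    · simp [h0]
    · rcases quadraticChar_dichotomy h0 with h | h <;> simp [h]
  have htot : (p : ℤ) = S1.card + S2.card + S0.card := by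
    have : (p : ℤ) = ∑ x : ZMod p, 1 := by simp [ZMod.card]
    rw [this]
    simp only [S0, S1, S2, Finset.card_filter, Nat.cast_sum, ← Finset.sum_add_distrib]
    refine Finset.sum_congr rfl fun x _ => ?_
    by_cases h0 : f.eval x = 0
    · simp [h0]
    · rcases quadraticChar_dichotomy h0 with h | h <;> simp [h]
  have htot' : (p : ℝ) = S1.card + S2.card + S0.card := by exact_mod_cast htot
  rw [hsum]
  push_cast
  have h1 : (S1.card : ℝ) ≤ _ := hcard 1
  have h2 : (S2.card : ℝ) ≤ _ := hcard (-1)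
  have hd1 : (1 : ℝ) ≤ d := by exact_mod_cast hd
  have h5 : (d : ℝ) ≤ d * Real.sqrt p := by nlinarith
  rw [abs_le]
  constructor <;> linarith

open Polynomial in
lemma abs_sum_quadraticChar_prod_le_of_zero_notMem {p : ℕ} [Fact p.Prime] (hp : p ≠ 2)
    (T : Finset (ZMod p)) (hT : T.Nonempty) (h0 : (0 : ZMod p) ∉ T) :
    |((∑ x : ZMod p, quadraticChar (ZMod p) (∏ b ∈ T, (x + b)) : ℤ) : ℝ)| ≤
      21 * T.card * Real.sqrt p := by
  set f : (ZMod p)[X] := ∏ b ∈ T, (X + C b) with hf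
  have hdeg : f.natDegree = T.card := by
    rw [hf, natDegree_prod_of_monic _ _ fun b _ => monic_X_add_C b]
    simp
  have hfm : f ≠ 0 := (monic_prod_of_monic _ _ fun b _ => monic_X_add_C b).ne_zero
  have heval : ∀ x, f.eval x = ∏ b ∈ T, (x + b) := fun x => by
    simp [hf, eval_prod]
  have hc : f.coeff 0 ≠ 0 := by
    rw [coeff_zero_eq_eval_zero, heval]
    refine Finset.prod_ne_zero_iff.mpr fun b hb h => h0 ?_
    rw [zero_add] at h
    rwa [← h]
  have hsq : ∀ a b : (ZMod p)[X], a ^ 2 * f = b ^ 2 * C (f.coeff 0) → a = 0 ∧ b = 0 := by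
    intro a b hab
    have hC : (C (f.coeff 0) : (ZMod p)[X]) ≠ 0 := C_ne_zero.mpr hc
    by_cases ha : a = 0
    · refine ⟨ha, ?_⟩
      rw [ha] at hab
      simpa [hC, hc] using hab.symm
    · exfalso
      have hb : b ≠ 0 := by
        rintro rfl
        simp [ha, hfm] at hab
      obtain ⟨t, ht⟩ := hT
      have h1 := congrArg (rootMultiplicity (-t)) hab
      have hfac : f = (X - C (-t)) * ∏ b ∈ T.erase t, (X + C b) := by
        rw [hf, ← Finset.mul_prod_erase T _ ht]
        simp
      have hmf : rootMultiplicity (-t) f = 1 := by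
        rw [hfac, rootMultiplicity_mul (hfac ▸ hfm), rootMultiplicity_X_sub_C_self,
          rootMultiplicity_eq_zero]
        rw [IsRoot.def, eval_prod]
        refine Finset.prod_ne_zero_iff.mpr fun b hb => ?_
        simp only [eval_add, eval_X, eval_C]
        intro h
        exact (Finset.mem_erase.mp hb).1 (neg_add_eq_zero.mp h).symm
      rw [rootMultiplicity_mul (mul_ne_zero (pow_ne_zero _ ha) hfm),
        rootMultiplicity_mul (mul_ne_zero (pow_ne_zero _ hb) hC), rootMultiplicity_C,
        hmf, pow_two, pow_two, rootMultiplicity_mul (mul_ne_zero ha ha),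
        rootMultiplicity_mul (mul_ne_zero hb hb)] at h1
      omega
  have := abs_sum_quadraticChar_eval_le hp (by rw [hdeg]; exact hT.card_pos) hsq
  simpa only [hdeg, heval] using this

lemma abs_sum_quadraticChar_prod_le {p : ℕ} [Fact p.Prime] (hp : p ≠ 2)
    (T : Finset (ZMod p)) (hT : T.Nonempty) :
    |((∑ x : ZMod p, quadraticChar (ZMod p) (∏ b ∈ T, (x + b)) : ℤ) : ℝ)| ≤
      21 * T.card * Real.sqrt p := by
  by_cases hu : T = Finset.univ
  · have hz : ∀ x : ZMod p, ∏ b ∈ T, (x + b) = 0 := fun x =>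
      Finset.prod_eq_zero (i := -x) (by simp [hu]) (by simp)
    simp only [hz, MulChar.map_zero, Finset.sum_const_zero, Int.cast_zero, abs_zero]
    positivity
  obtain ⟨c, hc⟩ : ∃ c, c ∉ T := by
    by_contra! h
    exact hu (Finset.eq_univ_iff_forall.mpr h)
  have hinj : Function.Injective fun b : ZMod p => b - c := sub_left_injective
  have := abs_sum_quadraticChar_prod_le_of_zero_notMem hp (T.image fun b => b - c)
    (hT.image _) (by
      simp only [Finset.mem_image, not_exists, not_and]
      intro b hb h
      exact hc (sub_eq_zero.mp h ▸ hb))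
  rw [Finset.card_image_of_injective _ hinj] at this
  have e : ∑ x : ZMod p, quadraticChar (ZMod p) (∏ b ∈ T, (x + b)) =
      ∑ x : ZMod p, quadraticChar (ZMod p) (∏ b ∈ T.image (fun b => b - c), (x + b)) := by
    rw [← Equiv.sum_comp (Equiv.subRight c)]
    refine Finset.sum_congr rfl fun x _ => ?_
    rw [Finset.prod_image fun a _ b _ h => hinj h]
    congr 1
    refine Finset.prod_congr rfl fun b _ => ?_
    simp only [Equiv.subRight_apply]
    ring
  rw [e]
  exact this

lemma mem_QR_iff {M : ℕ} [NeZero M] (x : ZMod M) : x ∈ QR M ↔ IsSquare x := by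
  rw [isSquare_iff_exists_sq, QR, Finset.mem_image]
  constructor
  · rintro ⟨a, -, rfl⟩
    exact ⟨a, rfl⟩
  · rintro ⟨y, rfl⟩
    exact ⟨y.val, Finset.mem_range.mpr y.val_lt, by rw [ZMod.natCast_zmod_val]⟩

lemma abs_sum_prod_one_add_quadraticChar_sub_le {p : ℕ} [Fact p.Prime] (hp : p ≠ 2)
    (D : Finset (ZMod p)) (ε : ZMod p → ℤ) (hε : ∀ b, ε b = 1 ∨ ε b = -1) :
    |((∑ x : ZMod p, ∏ b ∈ D, (1 + ε b * quadraticChar (ZMod p) (x + b)) : ℤ) : ℝ) - p| ≤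
      2 ^ D.card * (21 * D.card * Real.sqrt p) := by
  have h1 : ∑ x : ZMod p, ∏ b ∈ D, (1 + ε b * quadraticChar (ZMod p) (x + b)) =
      ∑ T ∈ D.powerset, (∏ b ∈ T, ε b) *
        ∑ x : ZMod p, quadraticChar (ZMod p) (∏ b ∈ T, (x + b)) := by
    simp only [Finset.prod_one_add, Finset.mul_sum]
    rw [Finset.sum_comm]
    refine Finset.sum_congr rfl fun T _ => Finset.sum_congr rfl fun x _ => ?_
    rw [Finset.prod_mul_distrib, map_prod]
  have h2 : ((∑ x : ZMod p, ∏ b ∈ D, (1 + ε b * quadraticChar (ZMod p) (x + b)) : ℤ) : ℝ) - p =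
      ∑ T ∈ D.powerset.erase ∅, (((∏ b ∈ T, ε b : ℤ) : ℝ) *
        ((∑ x : ZMod p, quadraticChar (ZMod p) (∏ b ∈ T, (x + b)) : ℤ) : ℝ)) := by
    rw [h1, ← Finset.add_sum_erase _ _ (Finset.empty_mem_powerset D)]
    simp [ZMod.card]
  rw [h2]
  refine (Finset.abs_sum_le_sum_abs _ _).trans ?_
  calc ∑ T ∈ D.powerset.erase ∅, |((∏ b ∈ T, ε b : ℤ) : ℝ) *
        ((∑ x : ZMod p, quadraticChar (ZMod p) (∏ b ∈ T, (x + b)) : ℤ) : ℝ)|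
      ≤ ∑ T ∈ D.powerset.erase ∅, (21 * D.card * Real.sqrt p) := by
        refine Finset.sum_le_sum fun T hT => ?_
        rw [Finset.mem_erase, Finset.mem_powerset, ← Finset.nonempty_iff_ne_empty] at hT
        have e1 : |((∏ b ∈ T, ε b : ℤ) : ℝ)| = 1 := by
          rw [← Int.cast_abs, Finset.abs_prod, Finset.prod_eq_one]
          · simp
          · intro b _
            rcases hε b with h | h <;> simp [h]
        rw [abs_mul, e1, one_mul]
        refine (abs_sum_quadraticChar_prod_le hp T hT.1).trans ?_
        have := Finset.card_le_card hT.2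
        gcongr
    _ ≤ ∑ T ∈ D.powerset, (21 * D.card * Real.sqrt p) :=
        Finset.sum_le_sum_of_subset_of_nonneg (Finset.erase_subset _ _)
          fun _ _ _ => by positivity
    _ = _ := by simp [Finset.card_powerset]

lemma card_filter_exists_add_eq_zero_le {p : ℕ} [NeZero p] (D : Finset (ZMod p)) :
    (Finset.univ.filter fun x : ZMod p => ∃ b ∈ D, x + b = 0).card ≤ D.card := by
  refine le_trans (Finset.card_le_card (t := D.image fun b => -b) fun x hx => ?_)
    Finset.card_image_le
  obtain ⟨b, hb, h⟩ := (Finset.mem_filter.mp hx).2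
  exact Finset.mem_image.mpr ⟨b, hb, (eq_neg_of_add_eq_zero_left h).symm⟩

/-- Patterns of quadratic residues and non-residues are equidistributed. -/
lemma abs_card_residue_pattern_sub_le {p : ℕ} [Fact p.Prime] (hp : p ≠ 2)
    (D E : Finset (ZMod p)) (hDE : Disjoint D E) :
    |((Finset.univ.filter fun x : ZMod p =>
        (∀ b ∈ D, x + b ∈ QR p) ∧ ∀ b ∈ E, x + b ∉ QR p).card : ℝ) -
          p / 2 ^ (D.card + E.card)| ≤ 22 * (D.card + E.card) * Real.sqrt p := by
  set P : ZMod p → Prop := fun x => (∀ b ∈ D, x + b ∈ QR p) ∧ ∀ b ∈ E, x + b ∉ QR p with hP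
  set U := D ∪ E with hU
  have hUc : U.card = D.card + E.card := Finset.card_union_of_disjoint hDE
  set ε : ZMod p → ℤ := fun b => if b ∈ D then 1 else -1 with hε
  have h1 := abs_sum_prod_one_add_quadraticChar_sub_le hp U ε fun b => by
    by_cases h : b ∈ D <;> simp [hε, h]
  set w : ZMod p → ℤ := fun x => ∏ b ∈ U, (1 + ε b * quadraticChar (ZMod p) (x + b)) with hw
  have hfac : ∀ x b, 0 ≤ 1 + ε b * quadraticChar (ZMod p) (x + b) ∧
      1 + ε b * quadraticChar (ZMod p) (x + b) ≤ 2 := by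
    intro x b
    have e1 : ε b = 1 ∨ ε b = -1 := by by_cases h : b ∈ D <;> simp [hε, h]
    by_cases h0 : x + b = 0
    · simp [h0]
    · rcases quadraticChar_dichotomy h0 with h | h <;> rcases e1 with e | e <;> simp [h, e]
  have hpt : ∀ x, |w x - 2 ^ U.card * (if P x then 1 else 0)| ≤
      2 ^ U.card * (if ∃ b ∈ U, x + b = 0 then 1 else 0) := by
    intro x
    by_cases hz : ∃ b ∈ U, x + b = 0
    · have hw0 : 0 ≤ w x := Finset.prod_nonneg fun b _ => (hfac x b).1
      have hw2 : w x ≤ 2 ^ U.card := by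
        rw [← Finset.prod_const]
        exact Finset.prod_le_prod (fun b _ => (hfac x b).1) fun b _ => (hfac x b).2
      have hpos : (0 : ℤ) ≤ 2 ^ U.card := by positivity
      rw [if_pos hz, abs_le]
      split_ifs <;> constructor <;> linarith
    · rw [if_neg hz, mul_zero]
      push Not at hz
      suffices w x = 2 ^ U.card * (if P x then 1 else 0) by rw [this]; simp
      by_cases hPx : P x
      · rw [if_pos hPx, mul_one, ← Finset.prod_const]
        refine Finset.prod_congr rfl fun b hb => ?_
        by_cases hbD : b ∈ D
        · have := (quadraticChar_one_iff_isSquare (hz b hb)).mpr ((mem_QR_iff _).mp (hPx.1 b hbD))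
          simp [hε, hbD, this]
        · have hbE : b ∈ E := (Finset.mem_union.mp hb).resolve_left hbD
          have := quadraticChar_neg_one_iff_not_isSquare.mpr
            fun h => hPx.2 b hbE ((mem_QR_iff _).mpr h)
          simp [hε, hbD, this]
      · rw [if_neg hPx, mul_zero]
        rw [hP, not_and_or] at hPx
        push Not at hPx
        rcases hPx with ⟨b, hb, h⟩ | ⟨b, hb, h⟩
        · refine Finset.prod_eq_zero (Finset.mem_union_left _ hb) ?_
          have := quadraticChar_neg_one_iff_not_isSquare.mpr
            fun h' => h ((mem_QR_iff _).mpr h')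
          simp [hε, hb, this]
        · refine Finset.prod_eq_zero (Finset.mem_union_right _ hb) ?_
          have := (quadraticChar_one_iff_isSquare (hz b (Finset.mem_union_right _ hb))).mpr
            ((mem_QR_iff _).mp h)
          have hbD : b ∉ D := Finset.disjoint_right.mp hDE hb
          simp [hε, hbD, this]
  have h2 : |(∑ x, w x) - 2 ^ U.card * ((Finset.univ.filter P).card : ℤ)| ≤
      2 ^ U.card * U.card := by
    have e1 : ((Finset.univ.filter P).card : ℤ) = ∑ x, if P x then 1 else 0 := by
      rw [Finset.card_filter]; push_cast; rfl
    rw [e1, Finset.mul_sum, ← Finset.sum_sub_distrib]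
    refine (Finset.abs_sum_le_sum_abs _ _).trans ((Finset.sum_le_sum fun x _ => hpt x).trans ?_)
    rw [← Finset.mul_sum]
    have := card_filter_exists_add_eq_zero_le U
    rw [Finset.card_filter] at this
    have h3 : (∑ x : ZMod p, if ∃ b ∈ U, x + b = 0 then (1 : ℤ) else 0) ≤ U.card := by
      exact_mod_cast this
    exact mul_le_mul_of_nonneg_left h3 (by positivity)
  have h2' : |((∑ x, w x : ℤ) : ℝ) - 2 ^ U.card * ((Finset.univ.filter P).card : ℝ)| ≤
      2 ^ U.card * U.card := by exact_mod_cast h2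
  have hsq : (1 : ℝ) ≤ Real.sqrt p := by
    rw [Real.one_le_sqrt]
    exact_mod_cast (Fact.out : p.Prime).one_lt.le
  have hk : (0 : ℝ) < 2 ^ U.card := by positivity
  rw [← hUc]
  have hcast : ((D.card : ℝ) + E.card) = U.card := by exact_mod_cast hUc.symm
  rw [hcast]
  have hX : ((Finset.univ.filter P).card : ℝ) - p / 2 ^ U.card =
      (2 ^ U.card * ((Finset.univ.filter P).card : ℝ) - p) / 2 ^ U.card := by
    field_simp
  rw [hX, abs_div, abs_of_pos hk, div_le_iff₀ hk]
  have h4 : (2 ^ U.card * ((Finset.univ.filter P).card : ℝ) - p) =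
      (((∑ x, w x : ℤ) : ℝ) - p) -
        (((∑ x, w x : ℤ) : ℝ) - 2 ^ U.card * ((Finset.univ.filter P).card : ℝ)) := by ring
  rw [h4]
  refine (abs_sub _ _).trans ?_
  have h5 : (U.card : ℝ) ≤ U.card * Real.sqrt p := le_mul_of_one_le_right (by positivity) hsq
  have h6 : (2 : ℝ) ^ U.card * U.card ≤ 2 ^ U.card * (U.card * Real.sqrt p) := by gcongr
  nlinarith

lemma card_mul_le_card_biUnion_add {ι α : Type*} [DecidableEq ι] [DecidableEq α] (s : Finset ι)
    (I : ι → Finset α) (k c : ℕ) (hI : ∀ a ∈ s, (I a).card = k)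
    (hc : ∀ a ∈ s, ∀ b ∈ s, a ≠ b → (I a ∩ I b).card ≤ c) :
    s.card * k ≤ (s.biUnion I).card + s.card * (s.card * c) := by
  induction s using Finset.induction_on with
  | empty => simp
  | insert a s ha ih =>
    have h1 := ih (fun b hb => hI b (Finset.mem_insert_of_mem hb))
      (fun b hb b' hb' => hc b (Finset.mem_insert_of_mem hb) b' (Finset.mem_insert_of_mem hb'))
    have h2 := Finset.card_union_add_card_inter (I a) (s.biUnion I)
    have h3 : (I a ∩ s.biUnion I).card ≤ s.card * c := by
      rw [Finset.inter_biUnion]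
      refine Finset.card_biUnion_le_card_mul _ _ _ fun b hb => ?_
      exact hc a (Finset.mem_insert_self _ _) b (Finset.mem_insert_of_mem hb)
        (fun h => ha (h ▸ hb))
    have h4 := hI a (Finset.mem_insert_self _ _)
    rw [Finset.biUnion_insert, Finset.card_insert_of_notMem ha]
    nlinarith

lemma card_le_of_separated (S : Finset ℕ) (k q : ℕ) (hS : ∀ x ∈ S, x < k)
    (hsep : ∀ x ∈ S, ∀ y ∈ S, x < y → q ≤ y - x) (hq : 0 < q) : S.card ≤ k / q + 1 := by
  rw [← Finset.card_range (k / q + 1)]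
  refine Finset.card_le_card_of_injOn (fun x => x / q) (fun x hx => ?_) fun x hx y hy h => ?_
  · have := Nat.div_le_div_right (c := q) (hS x hx).le
    simpa [Nat.lt_succ_iff] using this
  · have key : ∀ x ∈ S, ∀ y ∈ S, x / q = y / q → ¬ x < y := by
      intro x hx y hy h hlt
      have h1 := hsep x hx y hy hlt
      have h2 := Nat.div_add_mod x q
      have h3 := Nat.div_add_mod y q
      have h4 := Nat.mod_lt x hq
      have h5 := Nat.mod_lt y hq
      rw [h] at h2
      omega
    exact le_antisymm (not_lt.mp (key y hy x hx h.symm)) (not_lt.mp (key x hx y hy h))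

lemma card_ratio_inter_le {p : ℕ} [Fact p.Prime] (y : ZMod p) (n k a a' : ℕ) (hn : 0 < n)
    (ha : 4 * n ^ 2 < a) (ha2 : a ≤ 4 * n ^ 2 + n) (ha' : 4 * n ^ 2 < a')
    (ha2' : a' ≤ 4 * n ^ 2 + n) (hne : a ≠ a') (hp : 2 * (k * (4 * n ^ 2 + n)) < p) :
    (((Finset.range k).image fun m : ℕ => (y + m) / (a : ZMod p)) ∩
      ((Finset.range k).image fun m : ℕ => (y + m) / (a' : ZMod p))).card ≤ k / (4 * n) + 1 := by
  rcases Nat.eq_zero_or_pos k with rfl | hk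
  · simp
  have hap : a < p := by nlinarith
  have hap' : a' < p := by nlinarith
  have hcast : ∀ b : ℕ, 4 * n ^ 2 < b → b < p → (b : ZMod p) ≠ 0 := fun b hb hbp h => by
    rw [ZMod.natCast_eq_zero_iff] at h
    exact absurd (Nat.le_of_dvd (by omega) h) (by omega)
  set S := (Finset.range k).filter fun m : ℕ =>
    ∃ m' < k, (y + m) * (a' : ZMod p) = (y + m') * (a : ZMod p) with hS
  have hsub : (((Finset.range k).image fun m : ℕ => (y + m) / (a : ZMod p)) ∩
      ((Finset.range k).image fun m : ℕ => (y + m) / (a' : ZMod p))) ⊆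
      S.image fun m : ℕ => (y + m) / (a : ZMod p) := by
    intro z hz
    obtain ⟨h1, h2⟩ := Finset.mem_inter.mp hz
    obtain ⟨m, hm, rfl⟩ := Finset.mem_image.mp h1
    obtain ⟨m', hm', h⟩ := Finset.mem_image.mp h2
    refine Finset.mem_image.mpr ⟨m, Finset.mem_filter.mpr ⟨hm, m', Finset.mem_range.mp hm', ?_⟩, rfl⟩
    exact ((div_eq_div_iff (hcast a' ha' hap') (hcast a ha hap)).mp h).symm
  refine (Finset.card_le_card hsub).trans (Finset.card_image_le.trans ?_)
  refine card_le_of_separated S k (4 * n) (fun x hx => Finset.mem_range.mp (Finset.mem_filter.mp hx).1)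
    (fun x₁ hx₁ x₂ hx₂ hlt => ?_) (by omega)
  obtain ⟨h1, m₁, hm₁, e₁⟩ := Finset.mem_filter.mp hx₁
  obtain ⟨h2, m₂, hm₂, e₂⟩ := Finset.mem_filter.mp hx₂
  rw [Finset.mem_range] at h1 h2
  by_contra! hcon
  have e3 : (((x₂ : ℤ) - x₁) * a' - ((m₂ : ℤ) - m₁) * a : ℤ) = 0 := by
    refine Int.eq_zero_of_abs_lt_dvd (m := p) ?_ ?_
    · rw [← ZMod.intCast_zmod_eq_zero_iff_dvd]
      push_cast
      linear_combination e₂ - e₁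
    · have b1 : |(x₂ : ℤ) - x₁| ≤ k := by rw [abs_le]; omega
      have b2 : |(m₂ : ℤ) - m₁| ≤ k := by rw [abs_le]; omega
      have c1 : |((x₂ : ℤ) - x₁) * a'| ≤ k * (4 * n ^ 2 + n) := by
        rw [abs_mul, Nat.abs_cast]
        have : (a' : ℤ) ≤ 4 * n ^ 2 + n := by exact_mod_cast ha2'
        gcongr
      have c2 : |((m₂ : ℤ) - m₁) * a| ≤ k * (4 * n ^ 2 + n) := by
        rw [abs_mul, Nat.abs_cast]
        have : (a : ℤ) ≤ 4 * n ^ 2 + n := by exact_mod_cast ha2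
        gcongr
      have hp' : 2 * ((k : ℤ) * (4 * n ^ 2 + n)) < p := by exact_mod_cast hp
      exact (abs_sub _ _).trans_lt (by linarith)
  have hdvd : (a : ℤ) ∣ ((x₂ : ℤ) - x₁) * ((a' : ℤ) - a) :=
    ⟨(m₂ : ℤ) - m₁ - ((x₂ : ℤ) - x₁), by linear_combination e3⟩
  have hzero := Int.eq_zero_of_abs_lt_dvd hdvd (by
    rw [abs_mul]
    have b1 : |(x₂ : ℤ) - x₁| ≤ 4 * n := by rw [abs_le]; omega
    have b2 : |(a' : ℤ) - a| ≤ n := by rw [abs_le]; constructor <;> omega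
    have : (4 * (n : ℤ) ^ 2) < a := by exact_mod_cast ha
    calc |(x₂ : ℤ) - x₁| * |(a' : ℤ) - a| ≤ 4 * n * n := by gcongr
      _ = 4 * (n : ℤ) ^ 2 := by ring
      _ < a := this)
  rcases mul_eq_zero.mp hzero with h | h
  · omega
  · exact hne (by omega)

/-- A long run of equal values of the quadratic character forces `p` to be small. -/
lemma mul_le_of_quadraticChar_run {p : ℕ} [Fact p.Prime] (hp2 : p ≠ 2) (y : ZMod p) (c : ℤ)
    (hc : c = 1 ∨ c = -1) (G n B k : ℕ)
    (hrun : ∀ t < G, quadraticChar (ZMod p) (y + (t : ℕ)) = c) (hn : 0 < n)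
    (hG : (4 * n ^ 2 + n) * B + k ≤ G) (hk : 4 * n ≤ k)
    (hp : 2 * (k * (4 * n ^ 2 + n)) < p) (hB : B ≤ p) :
    (n * k : ℝ) ≤ 4 * (p / 2 ^ B + 22 * B * Real.sqrt p) := by
  set s := Finset.Ioc (4 * n ^ 2) (4 * n ^ 2 + n) with hs
  set I : ℕ → Finset (ZMod p) := fun a =>
    (Finset.range k).image fun m : ℕ => (y + m) / (a : ZMod p) with hI
  have hkp : k < p := by nlinarith
  have hap : ∀ a ∈ s, (a : ZMod p) ≠ 0 := fun a ha h => by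
    rw [ZMod.natCast_eq_zero_iff] at h
    rw [hs, Finset.mem_Ioc] at ha
    have := Nat.le_of_dvd (by omega) h
    nlinarith
  have hcast : ∀ N ≤ p, Set.InjOn (fun m : ℕ => (m : ZMod p)) (Finset.range N) := by
    intro N hN m hm m' hm' h
    have h1 := Finset.mem_range.mp hm
    have h2 := Finset.mem_range.mp hm'
    have h3 := (ZMod.natCast_eq_natCast_iff' _ _ _).mp h
    rwa [Nat.mod_eq_of_lt (by omega), Nat.mod_eq_of_lt (by omega)] at h3
  have hIc : ∀ a ∈ s, (I a).card = k := fun a ha => by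
    rw [hI, Finset.card_image_of_injOn, Finset.card_range]
    intro m hm m' hm' h
    refine hcast k hkp.le hm hm' ?_
    have h1 := (div_left_inj' (hap a ha)).mp h
    exact add_left_cancel h1
  have h1 := card_mul_le_card_biUnion_add s I k (k / (4 * n) + 1) hIc fun a ha b hb hab => by
    rw [hs, Finset.mem_Ioc] at ha hb
    exact card_ratio_inter_le y n k a b hn ha.1 ha.2 hb.1 hb.2 hab hp
  have hsc : s.card = n := by simp [hs]
  rw [hsc] at h1
  have h2 : n * k ≤ 2 * (s.biUnion I).card := by
    have e1 : 4 * n * (k / (4 * n)) ≤ k := Nat.mul_div_le _ _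
    have e2 : 2 * (n * (k / (4 * n) + 1)) ≤ k := by nlinarith
    have e3 : n * (2 * (n * (k / (4 * n) + 1))) ≤ n * k := Nat.mul_le_mul_left _ e2
    linarith
  set D := (Finset.range B).image fun m : ℕ => (m : ZMod p) with hD
  have hDc : D.card = B := by
    rw [hD, Finset.card_image_of_injOn (hcast B hB), Finset.card_range]
  have h3 := abs_card_residue_pattern_sub_le hp2 D ∅ (Finset.disjoint_empty_right _)
  have h4 := abs_card_residue_pattern_sub_le hp2 ∅ D (Finset.disjoint_empty_left _)
  set Z₁ := Finset.univ.filter fun x : ZMod p =>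
        (∀ b ∈ D, x + b ∈ QR p) ∧ ∀ b ∈ (∅ : Finset (ZMod p)), x + b ∉ QR p
  set Z₂ := Finset.univ.filter fun x : ZMod p =>
        (∀ b ∈ (∅ : Finset (ZMod p)), x + b ∈ QR p) ∧ ∀ b ∈ D, x + b ∉ QR p
  have hsub : s.biUnion I ⊆ Z₁ ∪ Z₂ := by
    intro z hz
    obtain ⟨a, ha, hza⟩ := Finset.mem_biUnion.mp hz
    obtain ⟨m, hm, rfl⟩ := Finset.mem_image.mp hza
    have ha0 := hap a ha
    rw [Finset.mem_range] at hm
    have hval : ∀ b < B, quadraticChar (ZMod p) ((y + m) / a + (b : ℕ)) =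
        c * quadraticChar (ZMod p) a := by
      intro b hb
      have hlt : m + a * b < G := by
        have : a ≤ 4 * n ^ 2 + n := (Finset.mem_Ioc.mp ha).2
        have h5 : a * b ≤ (4 * n ^ 2 + n) * B := Nat.mul_le_mul this hb.le
        omega
      have h6 := hrun _ hlt
      have h7 : y + ((m + a * b : ℕ) : ZMod p) = ((y + m) / a + (b : ℕ)) * a := by
        push_cast
        field_simp
        ring
      rw [h7, map_mul] at h6
      rcases quadraticChar_dichotomy ha0 with h | h <;> rw [h] at h6 ⊢ <;> linarith
    have hcd : c * quadraticChar (ZMod p) a = 1 ∨ c * quadraticChar (ZMod p) a = -1 := by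
      rcases quadraticChar_dichotomy ha0 with h | h <;> rcases hc with h' | h' <;> simp [h, h']
    rw [Finset.mem_union]
    rcases hcd with h | h
    · left
      refine Finset.mem_filter.mpr ⟨Finset.mem_univ _, fun b hb => ?_, by simp⟩
      obtain ⟨t, ht, rfl⟩ := Finset.mem_image.mp hb
      have h8 := hval t (Finset.mem_range.mp ht)
      rw [h] at h8
      rw [mem_QR_iff]
      by_contra hns
      rw [quadraticChar_neg_one_iff_not_isSquare.mpr hns] at h8
      norm_num at h8
    · right
      refine Finset.mem_filter.mpr ⟨Finset.mem_univ _, by simp, fun b hb => ?_⟩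
      obtain ⟨t, ht, rfl⟩ := Finset.mem_image.mp hb
      have h8 := hval t (Finset.mem_range.mp ht)
      rw [h] at h8
      rw [mem_QR_iff]
      exact quadraticChar_neg_one_iff_not_isSquare.mp h8
  have h5 : (n * k : ℝ) ≤ 2 * (Z₁.card + Z₂.card) := by
    have := (Finset.card_le_card hsub).trans (Finset.card_union_le _ _)
    exact_mod_cast h2.trans (Nat.mul_le_mul_left 2 this)
  simp only [hDc, Finset.card_empty, Nat.cast_zero, zero_add, add_zero] at h3 h4
  have h6 := (abs_le.mp h3).2
  have h7 := (abs_le.mp h4).2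
  linarith

lemma cycGap_mem {M : ℕ} [NeZero M] {U : Finset (ZMod M)} {u : ZMod M} (hu : u ∈ U) :
    0 < cycGap M U u ∧ u + (cycGap M U u : ZMod M) ∈ U :=
  Nat.sInf_mem (s := {k : ℕ | 0 < k ∧ u + (k : ZMod M) ∈ U})
    ⟨M, Nat.pos_of_ne_zero (NeZero.ne M), by simpa using hu⟩

lemma add_notMem_of_lt_cycGap {M : ℕ} {U : Finset (ZMod M)} {u : ZMod M} {k : ℕ} (hk : 0 < k)
    (h : k < cycGap M U u) : u + (k : ZMod M) ∉ U :=
  fun hmem => Nat.notMem_of_lt_sInf h ⟨hk, hmem⟩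

lemma cycGap_eq_iff {M : ℕ} [NeZero M] {U : Finset (ZMod M)} {u : ZMod M} (hu : u ∈ U) {h : ℕ}
    (hh : 0 < h) : cycGap M U u = h ↔
      u + (h : ZMod M) ∈ U ∧ ∀ k ∈ Finset.Ico 1 h, u + (k : ZMod M) ∉ U := by
  constructor
  · rintro rfl
    refine ⟨(cycGap_mem hu).2, fun k hk => ?_⟩
    rw [Finset.mem_Ico] at hk
    exact add_notMem_of_lt_cycGap hk.1 hk.2
  · rintro ⟨h1, h2⟩
    have h3 := cycGap_mem hu
    refine le_antisymm (Nat.sInf_le ⟨hh, h1⟩) (not_lt.mp fun hlt => ?_)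
    exact h2 _ (Finset.mem_Ico.mpr ⟨h3.1, hlt⟩) h3.2

/-- The total length of the long gaps is controlled by the number of long empty windows. -/
lemma sum_cycGap_le {M : ℕ} [NeZero M] (U : Finset (ZMod M)) (L H : ℕ) (hLH : 2 * H ≤ L) :
    ∑ u ∈ U.filter (fun u => L < cycGap M U u), cycGap M U u ≤
      2 * (Finset.univ.filter fun w : ZMod M =>
        ∀ k ∈ Finset.Icc 1 H, w + (k : ZMod M) ∉ U).card := by
  set V := U.filter fun u => L < cycGap M U u
  set W := Finset.univ.filter fun w : ZMod M => ∀ k ∈ Finset.Icc 1 H, w + (k : ZMod M) ∉ U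
  have h1 : (V.sigma fun u => Finset.range (cycGap M U u - H)).card ≤ W.card := by
    refine Finset.card_le_card_of_injOn (fun x => x.1 + (x.2 : ZMod M)) ?_ ?_
    · rintro ⟨u, s⟩ hx
      rw [Finset.mem_coe, Finset.mem_sigma, Finset.mem_range] at hx
      simp only at hx
      refine Finset.mem_coe.mpr (Finset.mem_filter.mpr ⟨Finset.mem_univ _, fun k hk => ?_⟩)
      rw [Finset.mem_Icc] at hk
      have := add_notMem_of_lt_cycGap (M := M) (U := U) (u := u) (k := s + k) (by omega) (by omega)
      simpa [add_assoc] using this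
    · have key : ∀ u ∈ V, ∀ u' ∈ V, ∀ s < cycGap M U u - H, ∀ s' < cycGap M U u' - H,
          u + (s : ZMod M) = u' + (s' : ZMod M) → ¬ s < s' := by
        intro u hu u' _ s _ s' hs' he hlt
        have h2 : u = u' + ((s' - s : ℕ) : ZMod M) := by
          rw [Nat.cast_sub hlt.le]
          linear_combination he
        refine add_notMem_of_lt_cycGap (M := M) (U := U) (u := u') (k := s' - s) (by omega)
          (by omega) ?_
        rw [← h2]
        exact (Finset.mem_filter.mp hu).1
      rintro ⟨u, s⟩ hx ⟨u', s'⟩ hx' he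
      rw [Finset.mem_coe, Finset.mem_sigma, Finset.mem_range] at hx hx'
      simp only at hx hx' he
      have hss : s = s' := le_antisymm
        (not_lt.mp (key u' hx'.1 u hx.1 s' hx'.2 s hx.2 he.symm))
        (not_lt.mp (key u hx.1 u' hx'.1 s hx.2 s' hx'.2 he))
      subst hss
      rw [add_right_cancel he]
  rw [Finset.card_sigma] at h1
  refine le_trans ?_ (Nat.mul_le_mul_left 2 h1)
  rw [Finset.mul_sum]
  refine Finset.sum_le_sum fun u hu => ?_
  have := (Finset.mem_filter.mp hu).2
  rw [Finset.card_range]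
  omega

lemma stoch_eq_sum_add_sum {M : ℕ} [NeZero M] (U : Finset (ZMod M)) (L : ℕ) :
    stoch M U = ∑ h ∈ Finset.Icc 1 L, h ^ 2 * (U.filter fun u => cycGap M U u = h).card +
      ∑ u ∈ U.filter (fun u => L < cycGap M U u), cycGap M U u ^ 2 := by
  rw [stoch, ← Finset.sum_filter_add_sum_filter_not U (fun u => L < cycGap M U u), add_comm]
  congr 1
  rw [← Finset.sum_fiberwise_of_maps_to (g := fun u => cycGap M U u) (t := Finset.Icc 1 L)]
  · refine Finset.sum_congr rfl fun h hh => ?_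
    rw [Finset.mem_Icc] at hh
    rw [Finset.filter_filter, mul_comm, ← smul_eq_mul, ← Finset.sum_const]
    refine Finset.sum_congr ?_ ?_
    · ext u
      simp only [Finset.mem_filter]
      constructor
      · rintro ⟨h1, -, h2⟩; exact ⟨h1, h2⟩
      · rintro ⟨h1, h2⟩; exact ⟨h1, by omega, h2⟩
    · intro u hu
      rw [(Finset.mem_filter.mp hu).2]
  · intro u hu
    rw [Finset.mem_filter] at hu
    rw [Finset.mem_Icc]
    exact ⟨(cycGap_mem hu.1).1, not_lt.mp hu.2⟩

lemma mem_QR_mul_iff {A p : ℕ} [NeZero A] [NeZero p] (hAp : A.Coprime p) (u : ZMod (A * p)) :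
    u ∈ QR (A * p) ↔ (ZMod.chineseRemainder hAp u).1 ∈ QR A ∧
      (ZMod.chineseRemainder hAp u).2 ∈ QR p := by
  rw [mem_QR_iff, mem_QR_iff, mem_QR_iff]
  constructor
  · rintro ⟨y, rfl⟩
    rw [map_mul]
    exact ⟨⟨_, rfl⟩, ⟨_, rfl⟩⟩
  · rintro ⟨⟨a, ha⟩, ⟨b, hb⟩⟩
    refine ⟨(ZMod.chineseRemainder hAp).symm (a, b), ?_⟩
    apply (ZMod.chineseRemainder hAp).injective
    rw [map_mul, RingEquiv.apply_symm_apply]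
    exact Prod.ext ha hb

lemma card_filter_chineseRemainder {A p : ℕ} [NeZero A] [NeZero p] (hAp : A.Coprime p)
    (P : ZMod A → ZMod p → Prop) [∀ i x, Decidable (P i x)] :
    (Finset.univ.filter fun u : ZMod (A * p) =>
      P (ZMod.chineseRemainder hAp u).1 (ZMod.chineseRemainder hAp u).2).card =
      ∑ i : ZMod A, (Finset.univ.filter fun x : ZMod p => P i x).card := by
  simp only [Finset.card_filter]
  rw [← Fintype.sum_prod_type' (f := fun i x => if P i x then 1 else 0)]
  exact Fintype.sum_equiv (ZMod.chineseRemainder hAp).toEquiv _ _ fun _ => rfl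

lemma natCast_injOn_range {p N : ℕ} (hN : N ≤ p) :
    Set.InjOn (fun m : ℕ => (m : ZMod p)) (Finset.range N) := by
  intro m hm m' hm' h
  have h1 := Finset.mem_range.mp hm
  have h2 := Finset.mem_range.mp hm'
  have h3 := (ZMod.natCast_eq_natCast_iff' _ _ _).mp h
  rwa [Nat.mod_eq_of_lt (by omega), Nat.mod_eq_of_lt (by omega)] at h3

lemma rij_le {A : ℕ} (i : ZMod A) (h : ℕ) : rij A i h ≤ h - 1 :=
  (Finset.card_filter_le _ _).trans (by simp)

lemma abs_card_cycGap_eq_sub_le {A p : ℕ} [NeZero A] [Fact p.Prime] (hp2 : p ≠ 2)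
    (hAp : A.Coprime p) {h : ℕ} (hh : 0 < h) (hhp : h < p) :
    |(((QR (A * p)).filter fun u => cycGap (A * p) (QR (A * p)) u = h).card : ℝ) -
      ∑ i ∈ (QR A).filter (fun i => i + (h : ZMod A) ∈ QR A), (p : ℝ) / 2 ^ (rij A i h + 2)| ≤
      A * (22 * (h + 1) * Real.sqrt p) := by
  have e1 : ((QR (A * p)).filter fun u => cycGap (A * p) (QR (A * p)) u = h) =
      Finset.univ.filter fun u : ZMod (A * p) =>
        (fun (i : ZMod A) (x : ZMod p) => (i ∈ QR A ∧ i + (h : ZMod A) ∈ QR A) ∧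
          (x ∈ QR p ∧ x + (h : ZMod p) ∈ QR p) ∧
          ∀ k ∈ Finset.Ico 1 h, i + (k : ZMod A) ∈ QR A → x + (k : ZMod p) ∉ QR p)
        (ZMod.chineseRemainder hAp u).1 (ZMod.chineseRemainder hAp u).2 := by
    ext u
    rw [Finset.mem_filter, Finset.mem_filter]
    by_cases hu : u ∈ QR (A * p)
    · rw [cycGap_eq_iff hu hh]
      simp only [mem_QR_mul_iff hAp, map_add, map_natCast, Prod.fst_add, Prod.snd_add,
        Prod.fst_natCast, Prod.snd_natCast, Finset.mem_univ, true_and]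
      tauto
    · have hu' := hu
      rw [mem_QR_mul_iff hAp] at hu'
      tauto
  rw [e1, card_filter_chineseRemainder hAp (fun (i : ZMod A) (x : ZMod p) =>
    (i ∈ QR A ∧ i + (h : ZMod A) ∈ QR A) ∧ (x ∈ QR p ∧ x + (h : ZMod p) ∈ QR p) ∧
      ∀ k ∈ Finset.Ico 1 h, i + (k : ZMod A) ∈ QR A → x + (k : ZMod p) ∉ QR p)]
  have e2 : (QR A).filter (fun i => i + (h : ZMod A) ∈ QR A) =
      Finset.univ.filter fun i => i ∈ QR A ∧ i + (h : ZMod A) ∈ QR A := by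
    ext; simp
  rw [e2, Finset.sum_filter, Nat.cast_sum, ← Finset.sum_sub_distrib]
  refine (Finset.abs_sum_le_sum_abs _ _).trans ?_
  have hterm : ∀ i : ZMod A, |((Finset.univ.filter fun x : ZMod p =>
      (i ∈ QR A ∧ i + (h : ZMod A) ∈ QR A) ∧ (x ∈ QR p ∧ x + (h : ZMod p) ∈ QR p) ∧
      ∀ k ∈ Finset.Ico 1 h, i + (k : ZMod A) ∈ QR A → x + (k : ZMod p) ∉ QR p).card : ℝ) -
      (if i ∈ QR A ∧ i + (h : ZMod A) ∈ QR A then (p : ℝ) / 2 ^ (rij A i h + 2) else 0)| ≤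
      22 * (h + 1) * Real.sqrt p := by
    intro i
    by_cases hi : i ∈ QR A ∧ i + (h : ZMod A) ∈ QR A
    swap
    · simp only [hi, false_and, Finset.filter_false, Finset.card_empty, if_false]
      simp
      positivity
    simp only [hi, and_self, if_true, true_and]
    have hinj : Set.InjOn (fun m : ℕ => (m : ZMod p)) (Finset.range (h + 1)) :=
      natCast_injOn_range hhp
    set D : Finset (ZMod p) := ({0, h} : Finset ℕ).image fun m : ℕ => (m : ZMod p) with hD
    set E₀ := (Finset.Ico 1 h).filter fun k : ℕ => i + (k : ZMod A) ∈ QR A with hE₀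
    set E : Finset (ZMod p) := E₀.image fun m : ℕ => (m : ZMod p) with hE
    have hD₀ : (({0, h} : Finset ℕ) : Set ℕ) ⊆ Finset.range (h + 1) := by
      intro m hm
      simp at hm ⊢
      omega
    have hE₀' : (E₀ : Set ℕ) ⊆ Finset.range (h + 1) := by
      intro m hm
      have := Finset.mem_Ico.mp (Finset.mem_filter.mp (Finset.mem_coe.mp hm)).1
      simp
      omega
    have hDc : D.card = 2 := by
      rw [hD, Finset.card_image_of_injOn (hinj.mono hD₀), Finset.card_pair hh.ne]
    have hEc : E.card = rij A i h := by
      rw [hE, Finset.card_image_of_injOn (hinj.mono hE₀'), rij]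
    have hDE : Disjoint D E := by
      rw [Finset.disjoint_left]
      intro z hz hz'
      obtain ⟨a, ha, rfl⟩ := Finset.mem_image.mp hz
      obtain ⟨b, hb, hab⟩ := Finset.mem_image.mp hz'
      have := hinj (hE₀' hb) (hD₀ ha) hab
      subst this
      have := Finset.mem_Ico.mp (Finset.mem_filter.mp hb).1
      simp at ha
      omega
    have h1 := abs_card_residue_pattern_sub_le hp2 D E hDE
    have e3 : (Finset.univ.filter fun x : ZMod p =>
        (∀ b ∈ D, x + b ∈ QR p) ∧ ∀ b ∈ E, x + b ∉ QR p) = Finset.univ.filter fun x : ZMod p =>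
        (x ∈ QR p ∧ x + (h : ZMod p) ∈ QR p) ∧
        ∀ k ∈ Finset.Ico 1 h, i + (k : ZMod A) ∈ QR A → x + (k : ZMod p) ∉ QR p := by
      ext x
      simp only [hD, hE, Finset.forall_mem_image, Finset.mem_filter]
      simp [hE₀]
    rw [e3, hDc, hEc, add_comm 2] at h1
    refine h1.trans ?_
    have h2 : rij A i h + 2 ≤ h + 1 := by have := rij_le i h; omega
    have h3 : (((2 : ℕ) : ℝ) + rij A i h) ≤ h + 1 := by
      have : ((rij A i h + 2 : ℕ) : ℝ) ≤ ((h + 1 : ℕ) : ℝ) := by exact_mod_cast h2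
      push_cast at this ⊢
      linarith
    gcongr
  refine (Finset.sum_le_sum fun i _ => hterm i).trans ?_
  simp [ZMod.card]

lemma add_notMem_QR_of_empty_window {A p : ℕ} [NeZero A] [NeZero p] (hAp : A.Coprime p)
    {G : ℕ} {w : ZMod (A * p)}
    (hw : ∀ k ∈ Finset.Icc 1 (A * G), w + (k : ZMod (A * p)) ∉ QR (A * p)) (t : ℕ) (ht : t < G) :
    (ZMod.chineseRemainder hAp w).2 +
      (((A - (ZMod.chineseRemainder hAp w).1.val : ℕ) : ZMod p) + A * t) ∉ QR p := by
  set i := (ZMod.chineseRemainder hAp w).1 with hi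
  intro hmem
  have hlt := i.val_lt
  have h1 : A * (t + 1) ≤ A * G := Nat.mul_le_mul_left _ ht
  rw [mul_add] at h1
  refine hw (A - i.val + A * t) (Finset.mem_Icc.mpr ⟨by omega, by omega⟩) ?_
  rw [mem_QR_mul_iff hAp]
  constructor
  · rw [mem_QR_iff]
    refine ⟨0, ?_⟩
    rw [map_add, map_natCast, Prod.fst_add, Prod.fst_natCast, ← hi]
    push_cast
    rw [Nat.cast_sub hlt.le]
    simp
  · rw [map_add, map_natCast, Prod.snd_add, Prod.snd_natCast]
    push_cast
    exact hmem

lemma natCast_ne_zero_of_coprime {A p : ℕ} [Fact p.Prime] (hAp : A.Coprime p) :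
    (A : ZMod p) ≠ 0 := fun h => by
  rw [ZMod.natCast_eq_zero_iff] at h
  exact (Fact.out : p.Prime).one_lt.ne' (Nat.Coprime.eq_one_of_dvd hAp.symm h)

lemma card_empty_window_le {A p : ℕ} [NeZero A] [Fact p.Prime] (hp2 : p ≠ 2)
    (hAp : A.Coprime p) {B : ℕ} (hB : B ≤ p) :
    ((Finset.univ.filter fun w : ZMod (A * p) =>
      ∀ k ∈ Finset.Icc 1 (A * B), w + (k : ZMod (A * p)) ∉ QR (A * p)).card : ℝ) ≤
      A * (p / 2 ^ B + 22 * B * Real.sqrt p) := by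
  have hA0 := natCast_ne_zero_of_coprime hAp
  have h1 : (Finset.univ.filter fun w : ZMod (A * p) =>
      ∀ k ∈ Finset.Icc 1 (A * B), w + (k : ZMod (A * p)) ∉ QR (A * p)).card ≤
      ∑ i : ZMod A, (Finset.univ.filter fun x : ZMod p =>
        ∀ t < B, x + (((A - i.val : ℕ) : ZMod p) + A * t) ∉ QR p).card := by
    rw [← card_filter_chineseRemainder hAp (fun (i : ZMod A) (x : ZMod p) =>
      ∀ t < B, x + (((A - i.val : ℕ) : ZMod p) + A * t) ∉ QR p)]
    refine Finset.card_le_card fun w hw => ?_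
    rw [Finset.mem_filter] at hw ⊢
    exact ⟨hw.1, add_notMem_QR_of_empty_window hAp hw.2⟩
  have h2 : ∀ i : ZMod A, ((Finset.univ.filter fun x : ZMod p =>
        ∀ t < B, x + (((A - i.val : ℕ) : ZMod p) + A * t) ∉ QR p).card : ℝ) ≤
      p / 2 ^ B + 22 * B * Real.sqrt p := by
    intro i
    set E := (Finset.range B).image fun t : ℕ => ((A - i.val : ℕ) : ZMod p) + A * t with hE
    have hEc : E.card = B := by
      rw [hE, Finset.card_image_of_injOn, Finset.card_range]
      intro a ha b hb hab
      refine natCast_injOn_range hB ha hb ?_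
      exact mul_left_cancel₀ hA0 (add_left_cancel hab)
    have h3 := abs_card_residue_pattern_sub_le hp2 ∅ E (Finset.disjoint_empty_left _)
    have e : (Finset.univ.filter fun x : ZMod p =>
        (∀ b ∈ (∅ : Finset (ZMod p)), x + b ∈ QR p) ∧ ∀ b ∈ E, x + b ∉ QR p) =
        Finset.univ.filter fun x : ZMod p =>
          ∀ t < B, x + (((A - i.val : ℕ) : ZMod p) + A * t) ∉ QR p := by
      ext x
      simp [hE]
    rw [e, hEc] at h3
    simp only [Finset.card_empty, Nat.cast_zero, zero_add] at h3
    linarith [(abs_le.mp h3).2]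
  calc _ ≤ ((∑ i : ZMod A, (Finset.univ.filter fun x : ZMod p =>
        ∀ t < B, x + (((A - i.val : ℕ) : ZMod p) + A * t) ∉ QR p).card : ℕ) : ℝ) := by
        exact_mod_cast h1
    _ ≤ ∑ _i : ZMod A, (p / 2 ^ B + 22 * B * Real.sqrt p) := by
        rw [Nat.cast_sum]
        exact Finset.sum_le_sum fun i _ => h2 i
    _ = _ := by simp [ZMod.card, mul_add]

lemma cycGap_QR_le {A p : ℕ} [NeZero A] [Fact p.Prime] (hp2 : p ≠ 2) (hAp : A.Coprime p)
    (G n B k : ℕ) (hn : 0 < n) (hG : (4 * n ^ 2 + n) * B + k ≤ G) (hk : 4 * n ≤ k)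
    (hp : 2 * (k * (4 * n ^ 2 + n)) < p) (hB : B ≤ p)
    (hlt : 4 * (p / 2 ^ B + 22 * B * Real.sqrt p) < n * k) (u : ZMod (A * p)) :
    cycGap (A * p) (QR (A * p)) u ≤ A * G := by
  by_contra! hcon
  have hA0 := natCast_ne_zero_of_coprime hAp
  have h1 := add_notMem_QR_of_empty_window hAp (G := G) (w := u) fun k hk => by
    rw [Finset.mem_Icc] at hk
    exact add_notMem_of_lt_cycGap hk.1 (by omega)
  set x := (ZMod.chineseRemainder hAp u).2 + ((A - (ZMod.chineseRemainder hAp u).1.val : ℕ) : ZMod p)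
    with hx
  refine absurd (mul_le_of_quadraticChar_run hp2 (x / A) (-quadraticChar (ZMod p) A) ?_ G n B k
    (fun t ht => ?_) hn hG hk hp hB) (not_le.mpr hlt)
  · rcases quadraticChar_dichotomy hA0 with h | h <;> simp [h]
  · have h2 := h1 t ht
    rw [← add_assoc, ← hx, mem_QR_iff] at h2
    have h3 := quadraticChar_neg_one_iff_not_isSquare.mpr h2
    have h4 : x + A * t = (x / A + t) * A := by field_simp
    rw [h4, map_mul] at h3
    rcases quadraticChar_dichotomy hA0 with h | h <;> rw [h] at h3 ⊢ <;> linarith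

lemma rij_mul_add {A : ℕ} [NeZero A] (i : ZMod A) {j : ℕ} (hj : 0 < j) (k : ℕ) :
    rij A i (A * k + j) = (QR A).card * k + rij A i j := by
  have hper : Function.Periodic (fun ν : ℕ => i + (ν : ZMod A) ∈ QR A) A := fun ν => by simp
  have hcount : Nat.count (fun ν : ℕ => i + (ν : ZMod A) ∈ QR A) A = (QR A).card := by
    rw [Nat.count_eq_card_filter_range]
    refine Finset.card_bij (fun ν _ => i + (ν : ZMod A)) (fun ν hν => (Finset.mem_filter.mp hν).2)
      (fun a ha b hb hab => ?_) (fun x hx => ⟨(x - i).val, ?_, by simp⟩)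
    · exact natCast_injOn_range le_rfl (Finset.mem_of_mem_filter a ha)
        (Finset.mem_of_mem_filter b hb) (add_left_cancel hab)
    · rw [Finset.mem_filter, Finset.mem_range]
      exact ⟨ZMod.val_lt _, by simpa using hx⟩
  induction k with
  | zero => simp
  | succ k ih =>
    have h1 : A * (k + 1) + j = A * k + j + A := by ring
    rw [h1, rij, ← Finset.Ico_union_Ico_eq_Ico (b := A * k + j) (by omega) (by omega),
      Finset.filter_union, Finset.card_union_of_disjoint, Nat.filter_Ico_card_eq_of_periodic _ _ _ hper,
      hcount]
    · rw [rij] at ih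
      rw [ih]
      ring
    · exact Finset.disjoint_filter_filter (Finset.Ico_disjoint_Ico_consecutive _ _ _)

/-- The weight of the distance `h` in the main term. -/
noncomputable def gapWeight (A h : ℕ) : ℝ :=
  ∑ i ∈ (QR A).filter (fun i => i + (h : ZMod A) ∈ QR A), (1 / 2 : ℝ) ^ rij A i h

lemma gapWeight_nonneg (A h : ℕ) : 0 ≤ gapWeight A h :=
  Finset.sum_nonneg fun _ _ => by positivity

lemma card_QR_le (A : ℕ) : (QR A).card ≤ A :=
  Finset.card_image_le.trans (by simp)

lemma card_QR_pos (A : ℕ) [NeZero A] : 0 < (QR A).card :=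
  Finset.card_pos.mpr ⟨0, (mem_QR_iff 0).mpr ⟨0, by simp⟩⟩

lemma gapWeight_le (A h : ℕ) : gapWeight A h ≤ A := by
  refine (Finset.sum_le_card_nsmul _ _ 1 fun i _ => pow_le_one₀ (by norm_num) (by norm_num)).trans ?_
  rw [nsmul_one]
  exact_mod_cast (Finset.card_filter_le _ _).trans (card_QR_le A)

lemma gapWeight_mul_add {A : ℕ} [NeZero A] {j : ℕ} (hj : 0 < j) (k : ℕ) :
    gapWeight A (A * k + j) = (1 / 2 : ℝ) ^ ((QR A).card * k) * gapWeight A j := by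
  rw [gapWeight, gapWeight, Finset.mul_sum]
  refine Finset.sum_congr (by simp) fun i _ => ?_
  rw [rij_mul_add i hj, pow_add]

lemma sum_Icc_mul_gapWeight {A : ℕ} [NeZero A] (K : ℕ) :
    ∑ h ∈ Finset.Icc 1 (A * K), (h : ℝ) ^ 2 * gapWeight A h =
      ∑ j ∈ Finset.Icc 1 A, gapWeight A j *
        ∑ k ∈ Finset.range K, (1 / 2 : ℝ) ^ ((QR A).card * k) * ((A : ℝ) * k + j) ^ 2 := by
  induction K with
  | zero => simp
  | succ K ih =>
    have h1 : Finset.Icc 1 (A * (K + 1)) =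
        (Finset.Icc 1 (A * K)).disjUnion ((Finset.Icc 1 A).map (addLeftEmbedding (A * K)))
          (by
            rw [Finset.disjoint_left]
            intro x hx hx'
            simp at hx hx'
            omega) := by
      ext x
      simp [mul_add]
      omega
    simp_rw [h1, Finset.sum_disjUnion, ih, Finset.sum_range_succ, mul_add, Finset.sum_add_distrib,
      Finset.sum_map, addLeftEmbedding_apply]
    congr 1
    refine Finset.sum_congr rfl fun j hj => ?_
    rw [gapWeight_mul_add (Finset.mem_Icc.mp hj).1]
    push_cast
    ring

lemma gA_half_eq (A : ℕ) : gA A (1 / 2) = ∑ j ∈ Finset.Icc 1 A, gapWeight A j *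
    ∑' k : ℕ, (1 / 2 : ℝ) ^ ((QR A).card * k) * ((A : ℝ) * k + j) ^ 2 := by
  rw [gA]
  refine Finset.sum_congr rfl fun j _ => ?_
  rw [gapWeight, Finset.sum_mul]

lemma succ_sq_le (k : ℕ) : ((k : ℝ) + 1) ^ 2 ≤ 10 * (3 / 2 : ℝ) ^ k := by
  rcases Nat.lt_or_ge k 4 with h | h
  · interval_cases k <;> norm_num
  · induction k, h using Nat.le_induction with
    | base => norm_num
    | succ k hk ih =>
      have : (4 : ℝ) ≤ k := by exact_mod_cast hk
      rw [pow_succ (3 / 2 : ℝ)]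
      push_cast
      nlinarith

lemma half_pow_mul_sq_le {A : ℕ} [NeZero A] {j : ℕ} (hj : j ≤ A) (k : ℕ) :
    (1 / 2 : ℝ) ^ ((QR A).card * k) * ((A : ℝ) * k + j) ^ 2 ≤ 10 * A ^ 2 * (3 / 4 : ℝ) ^ k := by
  have h1 : (1 / 2 : ℝ) ^ ((QR A).card * k) ≤ (1 / 2) ^ k :=
    pow_le_pow_of_le_one (by norm_num) (by norm_num) (Nat.le_mul_of_pos_left _ (card_QR_pos A))
  have h2 : ((A : ℝ) * k + j) ^ 2 ≤ A ^ 2 * ((k : ℝ) + 1) ^ 2 := by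
    rw [← mul_pow, mul_add, mul_one]
    gcongr
  calc _ ≤ (1 / 2 : ℝ) ^ k * (A ^ 2 * (10 * (3 / 2 : ℝ) ^ k)) :=
        mul_le_mul h1 (h2.trans (by gcongr; exact succ_sq_le k)) (by positivity) (by positivity)
    _ = 10 * A ^ 2 * ((1 / 2 : ℝ) * (3 / 2)) ^ k := by rw [mul_pow]; ring
    _ = _ := by norm_num

lemma abs_gA_half_sub_le {A : ℕ} [NeZero A] (B : ℕ) :
    |∑ h ∈ Finset.Icc 1 (A * (3 * B)), (h : ℝ) ^ 2 * gapWeight A h - gA A (1 / 2)| ≤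
      40 * A ^ 4 / 2 ^ B := by
  rw [sum_Icc_mul_gapWeight, gA_half_eq, ← Finset.sum_sub_distrib]
  refine (Finset.abs_sum_le_sum_abs _ _).trans ?_
  have hterm : ∀ j ∈ Finset.Icc 1 A, |gapWeight A j *
      ∑ k ∈ Finset.range (3 * B), (1 / 2 : ℝ) ^ ((QR A).card * k) * ((A : ℝ) * k + j) ^ 2 -
      gapWeight A j * ∑' k : ℕ, (1 / 2 : ℝ) ^ ((QR A).card * k) * ((A : ℝ) * k + j) ^ 2| ≤
      40 * A ^ 3 / 2 ^ B := by
    intro j hj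
    set f : ℕ → ℝ := fun k => (1 / 2 : ℝ) ^ ((QR A).card * k) * ((A : ℝ) * k + j) ^ 2 with hf
    have hf0 : ∀ k, 0 ≤ f k := fun k => by positivity
    have hfle : ∀ k, f k ≤ 10 * A ^ 2 * (3 / 4 : ℝ) ^ k :=
      half_pow_mul_sq_le (Finset.mem_Icc.mp hj).2
    have hgeo : HasSum (fun k : ℕ => (3 / 4 : ℝ) ^ k) 4 := by
      convert hasSum_geometric_of_lt_one (r := (3 / 4 : ℝ)) (by norm_num) (by norm_num) using 1
      norm_num
    have hsum : Summable f := Summable.of_nonneg_of_le hf0 hfle (hgeo.summable.mul_left _)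
    have htail : ∑' k, f (k + 3 * B) ≤ 40 * A ^ 2 / 2 ^ B := by
      have hgeo' := hgeo.mul_left (10 * (A : ℝ) ^ 2 * (3 / 4) ^ (3 * B))
      have h1 : ∑' k, f (k + 3 * B) ≤ 10 * (A : ℝ) ^ 2 * (3 / 4) ^ (3 * B) * 4 := by
        rw [← hgeo'.tsum_eq]
        refine Summable.tsum_le_tsum (fun k => (hfle _).trans ?_)
          ((summable_nat_add_iff _).mpr hsum) hgeo'.summable
        rw [pow_add]
        exact le_of_eq (by ring)
      have h2 : (3 / 4 : ℝ) ^ (3 * B) ≤ 1 / 2 ^ B := by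
        rw [pow_mul, ← one_div_pow]
        exact pow_le_pow_left₀ (by norm_num) (by norm_num) _
      calc _ ≤ _ := h1
        _ ≤ 10 * (A : ℝ) ^ 2 * (1 / 2 ^ B) * 4 := by gcongr
        _ = _ := by ring
    have h0 : 0 ≤ ∑' k, f (k + 3 * B) := tsum_nonneg fun k => hf0 _
    rw [← hsum.sum_add_tsum_nat_add (3 * B), ← mul_sub, abs_mul, sub_add_cancel_left, abs_neg,
      abs_of_nonneg h0, abs_of_nonneg (gapWeight_nonneg A j)]
    calc _ ≤ (A : ℝ) * (40 * A ^ 2 / 2 ^ B) :=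
          mul_le_mul (gapWeight_le A j) htail h0 (by positivity)
      _ = _ := by ring
  refine (Finset.sum_le_sum hterm).trans (le_of_eq ?_)
  rw [Finset.sum_const, Nat.card_Icc, nsmul_eq_mul, Nat.add_sub_cancel]
  ring

lemma abs_sum_cycGap_head_sub_le {A p : ℕ} [NeZero A] [Fact p.Prime] (hp2 : p ≠ 2)
    (hAp : A.Coprime p) {L : ℕ} (hL : L < p) :
    |((∑ h ∈ Finset.Icc 1 L,
        h ^ 2 * ((QR (A * p)).filter fun u => cycGap (A * p) (QR (A * p)) u = h).card : ℕ) : ℝ) -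
      0.25 * p * ∑ h ∈ Finset.Icc 1 L, (h : ℝ) ^ 2 * gapWeight A h| ≤
      22 * A * (L ^ 3 * (L + 1)) * Real.sqrt p := by
  rw [Nat.cast_sum, Finset.mul_sum, ← Finset.sum_sub_distrib]
  refine (Finset.abs_sum_le_sum_abs _ _).trans ?_
  have hterm : ∀ h ∈ Finset.Icc 1 L,
      |((h ^ 2 * ((QR (A * p)).filter fun u => cycGap (A * p) (QR (A * p)) u = h).card : ℕ) : ℝ) -
        0.25 * p * ((h : ℝ) ^ 2 * gapWeight A h)| ≤ L ^ 2 * (A * (22 * (L + 1) * Real.sqrt p)) := by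
    intro h hh
    rw [Finset.mem_Icc] at hh
    have h1 := abs_card_cycGap_eq_sub_le hp2 hAp hh.1 (hh.2.trans_lt hL)
    have h2 : ∑ i ∈ (QR A).filter (fun i => i + (h : ZMod A) ∈ QR A),
        (p : ℝ) / 2 ^ (rij A i h + 2) = 0.25 * p * gapWeight A h := by
      rw [gapWeight, Finset.mul_sum]
      refine Finset.sum_congr rfl fun i _ => ?_
      rw [pow_add, one_div_pow]
      field_simp
      ring
    rw [h2] at h1
    have h3 : (h : ℝ) ≤ L := by exact_mod_cast hh.2
    push_cast
    rw [mul_left_comm (0.25 * (p : ℝ)), ← mul_sub, abs_mul, abs_of_nonneg (by positivity)]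
    refine mul_le_mul (by gcongr) (h1.trans (by gcongr)) (abs_nonneg _) (by positivity)
  refine (Finset.sum_le_sum hterm).trans (le_of_eq ?_)
  rw [Finset.sum_const, Nat.card_Icc, nsmul_eq_mul, Nat.add_sub_cancel]
  ring

lemma sum_cycGap_tail_le {A p : ℕ} [NeZero A] [Fact p.Prime] (hp2 : p ≠ 2)
    (hAp : A.Coprime p) {B G : ℕ} (hB : B ≤ p)
    (hG : ∀ u : ZMod (A * p), cycGap (A * p) (QR (A * p)) u ≤ A * G) :
    ((∑ u ∈ (QR (A * p)).filter (fun u => A * (3 * B) < cycGap (A * p) (QR (A * p)) u),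
      cycGap (A * p) (QR (A * p)) u ^ 2 : ℕ) : ℝ) ≤
      2 * A ^ 2 * G * (p / 2 ^ B + 22 * B * Real.sqrt p) := by
  have h1 := sum_cycGap_le (QR (A * p)) (A * (3 * B)) (A * B)
    (by rw [mul_left_comm]; gcongr; norm_num)
  have h2 : ∑ u ∈ (QR (A * p)).filter (fun u => A * (3 * B) < cycGap (A * p) (QR (A * p)) u),
      cycGap (A * p) (QR (A * p)) u ^ 2 ≤ A * G *
      ∑ u ∈ (QR (A * p)).filter (fun u => A * (3 * B) < cycGap (A * p) (QR (A * p)) u),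
        cycGap (A * p) (QR (A * p)) u := by
    rw [Finset.mul_sum]
    refine Finset.sum_le_sum fun u _ => ?_
    rw [sq]
    exact Nat.mul_le_mul_right _ (hG u)
  have h3 := card_empty_window_le hp2 hAp hB
  calc _ ≤ ((A * G * (2 * (Finset.univ.filter fun w : ZMod (A * p) =>
        ∀ k ∈ Finset.Icc 1 (A * B), w + (k : ZMod (A * p)) ∉ QR (A * p)).card) : ℕ) : ℝ) := by
        exact_mod_cast h2.trans (Nat.mul_le_mul_left _ h1)
    _ ≤ A * G * (2 * (A * (p / 2 ^ B + 22 * B * Real.sqrt p))) := by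
        push_cast
        gcongr
    _ = _ := by ring

lemma abs_stoch_QR_sub_le {A p : ℕ} [NeZero A] [Fact p.Prime] (hp2 : p ≠ 2)
    (hAp : A.Coprime p) {B G : ℕ} (hB : B ≤ p) (hL : A * (3 * B) < p)
    (hG : ∀ u : ZMod (A * p), cycGap (A * p) (QR (A * p)) u ≤ A * G) :
    |(stoch (A * p) (QR (A * p)) : ℝ) - 0.25 * gA A (1 / 2) * p| ≤
      22 * A * ((A * (3 * B)) ^ 3 * (A * (3 * B) + 1)) * Real.sqrt p +
      2 * A ^ 2 * G * (p / 2 ^ B + 22 * B * Real.sqrt p) + 10 * A ^ 4 * (p / 2 ^ B) := by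
  have h1 := abs_sum_cycGap_head_sub_le hp2 hAp hL
  have h2 := sum_cycGap_tail_le hp2 hAp hB hG
  have h3 := abs_gA_half_sub_le (A := A) B
  rw [stoch_eq_sum_add_sum _ (A * (3 * B)), Nat.cast_add]
  set H := ((∑ h ∈ Finset.Icc 1 (A * (3 * B)),
    h ^ 2 * ((QR (A * p)).filter fun u => cycGap (A * p) (QR (A * p)) u = h).card : ℕ) : ℝ)
  set T := ((∑ u ∈ (QR (A * p)).filter (fun u => A * (3 * B) < cycGap (A * p) (QR (A * p)) u),
      cycGap (A * p) (QR (A * p)) u ^ 2 : ℕ) : ℝ)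
  set W := ∑ h ∈ Finset.Icc 1 (A * (3 * B)), (h : ℝ) ^ 2 * gapWeight A h
  have hT : 0 ≤ T := Nat.cast_nonneg _
  have e : H + T - 0.25 * gA A (1 / 2) * p =
      (H - 0.25 * p * W) + T + 0.25 * p * (W - gA A (1 / 2)) := by ring
  have h4 : |0.25 * (p : ℝ) * (W - gA A (1 / 2))| ≤ 10 * A ^ 4 * (p / 2 ^ B) := by
    rw [abs_mul, abs_of_nonneg (by positivity)]
    calc _ ≤ 0.25 * (p : ℝ) * (40 * A ^ 4 / 2 ^ B) := by gcongr
      _ = _ := by ring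
  push_cast at h1
  rw [e]
  refine (abs_add_three _ _ _).trans ?_
  rw [abs_of_nonneg hT]
  exact add_le_add (add_le_add h1 h2) h4

lemma cycGap_QR_le_floor {A p : ℕ} [NeZero A] [Fact p.Prime] (hp2 : p ≠ 2)
    (hAp : A.Coprime p) {B : ℕ} {P : ℝ} (hP : 1000 ≤ P) (hPp : P ^ 20 = p)
    (hB : 1000 * (B : ℝ) ≤ P) (hpB : p < 2 ^ B) (hBp : B ≤ p) (u : ZMod (A * p)) :
    cycGap (A * p) (QR (A * p)) u ≤ A * ⌊P ^ 8⌋₊ := by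
  have hP0 : 0 < P := by linarith
  have hP3 : 1000 ≤ P ^ 3 := hP.trans (le_self_pow₀ (by linarith) (by norm_num))
  have hP8 : 1000 * P ^ 7 ≤ P ^ 8 := by
    rw [pow_succ P 7, mul_comm]
    gcongr
  have hP7 : 1000 * P ^ 6 ≤ P ^ 7 := by
    rw [pow_succ P 6, mul_comm]
    gcongr
  have hP37 : P ^ 3 ≤ P ^ 7 := pow_le_pow_right₀ (by linarith) (by norm_num)
  set n := ⌊P ^ 3⌋₊ with hn
  set k := ⌊P ^ 8 / 2⌋₊ with hk
  have hn1 : (n : ℝ) ≤ P ^ 3 := Nat.floor_le (by positivity)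
  have hn2 : P ^ 3 / 2 ≤ n := by linarith [Nat.lt_floor_add_one (P ^ 3)]
  have hk1 : (k : ℝ) ≤ P ^ 8 / 2 := Nat.floor_le (by positivity)
  have hk2 : P ^ 8 / 4 ≤ k := by linarith [Nat.lt_floor_add_one (P ^ 8 / 2)]
  have hn0 : 0 < n := Nat.floor_pos.mpr (by linarith)
  have hn5 : (4 * n ^ 2 + n : ℝ) ≤ 5 * P ^ 6 := by
    have : (1 : ℝ) ≤ n := by exact_mod_cast hn0
    have : (n : ℝ) ^ 2 ≤ (P ^ 3) ^ 2 := by gcongr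
    nlinarith
  have hsqrt : Real.sqrt p = P ^ 10 := by
    rw [← hPp, show P ^ 20 = (P ^ 10) ^ 2 by ring, Real.sqrt_sq (by positivity)]
  have hp1 : (p : ℝ) / 2 ^ B ≤ 1 := by
    rw [div_le_one (by positivity)]
    exact_mod_cast hpB.le
  refine cycGap_QR_le hp2 hAp ⌊P ^ 8⌋₊ n B k hn0 (Nat.le_floor ?_) ?_ ?_ hBp ?_ u
  · push_cast
    calc (4 * (n : ℝ) ^ 2 + n) * B + k ≤ 5 * P ^ 6 * (P / 1000) + P ^ 8 / 2 := by
          gcongr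
          linarith
      _ ≤ P ^ 8 := by
          rw [show 5 * P ^ 6 * (P / 1000) = P ^ 7 / 200 by ring]
          linarith
  · have : (4 * n : ℝ) ≤ k := by linarith
    exact_mod_cast this
  · have : (2 * (k * (4 * n ^ 2 + n)) : ℝ) < p := by
      calc _ ≤ 2 * (P ^ 8 / 2 * (5 * P ^ 6)) := by gcongr
        _ = 5 * P ^ 14 := by ring
        _ < P ^ 6 * P ^ 14 := by
          gcongr
          linarith [le_self_pow₀ (by linarith : 1 ≤ P) (by norm_num : 6 ≠ 0)]
        _ = p := by rw [← hPp]; ring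
    exact_mod_cast this
  · rw [hsqrt]
    have h1 : P ^ 3 / 2 * (P ^ 8 / 4) ≤ n * k := by gcongr
    have h2 : (B : ℝ) * P ^ 10 ≤ P / 1000 * P ^ 10 := by
      gcongr
      linarith
    have h3 : 1000 ≤ P ^ 11 := hP.trans (le_self_pow₀ (by linarith) (by norm_num))
    rw [show P ^ 3 / 2 * (P ^ 8 / 4) = P ^ 11 / 8 by ring] at h1
    rw [show P / 1000 * P ^ 10 = P ^ 11 / 1000 by ring] at h2
    linarith

lemma abs_stoch_QR_sub_le_pow {A p : ℕ} [NeZero A] [Fact p.Prime] (hp2 : p ≠ 2)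
    (hAp : A.Coprime p) {B : ℕ} {P : ℝ} (hP : 1000 ≤ P) (hPp : P ^ 20 = p)
    (hB : 1000 * (B : ℝ) ≤ P) (hpB : p < 2 ^ B) (hA : (A : ℝ) ≤ 0.1 * P ^ 2) :
    |(stoch (A * p) (QR (A * p)) : ℝ) - 0.25 * gA A (1 / 2) * p| ≤ 3 * A ^ 3 * P ^ 19 := by
  have hP0 : 0 < P := by linarith
  have hA1 : (1 : ℝ) ≤ A := by exact_mod_cast Nat.one_le_iff_ne_zero.mpr (NeZero.ne A)
  have hB1 : (1 : ℝ) ≤ B := by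
    rw [Nat.one_le_cast, Nat.one_le_iff_ne_zero]
    rintro rfl
    have := (Fact.out : p.Prime).two_le
    omega
  have hB' : (B : ℝ) ≤ P / 1000 := by linarith
  have hPpow : ∀ {a b : ℕ}, a ≤ b → P ^ a ≤ P ^ b := pow_le_pow_right₀ (by linarith)
  have hBp : B ≤ p := by
    have : (B : ℝ) ≤ p := by
      rw [← hPp]
      linarith [hPpow (show 1 ≤ 20 by norm_num)]
    exact_mod_cast this
  have hL : A * (3 * B) < p := by
    have : (A * (3 * B) : ℝ) < p := by
      calc (A * (3 * B) : ℝ) ≤ 0.1 * P ^ 2 * (3 * (P / 1000)) := by gcongr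
        _ = 3 / 10000 * P ^ 3 := by ring
        _ < P ^ 3 := by linarith [pow_pos hP0 3]
        _ ≤ p := hPp ▸ hPpow (by norm_num)
    exact_mod_cast this
  have hsqrt : Real.sqrt p = P ^ 10 := by
    rw [← hPp, show P ^ 20 = (P ^ 10) ^ 2 by ring, Real.sqrt_sq (by positivity)]
  have hp1 : (p : ℝ) / 2 ^ B ≤ 1 := by
    rw [div_le_one (by positivity)]
    exact_mod_cast hpB.le
  refine (abs_stoch_QR_sub_le hp2 hAp hBp hL
    (cycGap_QR_le_floor hp2 hAp hP hPp hB hpB hBp)).trans ?_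
  rw [hsqrt]
  have h1 : 22 * (A : ℝ) * ((A * (3 * B)) ^ 3 * (A * (3 * B) + 1)) * P ^ 10 ≤ A ^ 3 * P ^ 19 := by
    have : (1 : ℝ) ≤ A * (3 * B) := by nlinarith
    calc _ ≤ 22 * (A : ℝ) * ((A * (3 * B)) ^ 3 * (2 * (A * (3 * B)))) * P ^ 10 := by
          gcongr
          linarith
      _ = 3564 * A ^ 3 * A ^ 2 * B ^ 4 * P ^ 10 := by ring
      _ ≤ 3564 * A ^ 3 * (0.1 * P ^ 2) ^ 2 * (P / 1000) ^ 4 * P ^ 10 := by gcongr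
      _ = 3564 / 10 ^ 14 * (A ^ 3 * P ^ 18) := by ring
      _ ≤ 1 * (A ^ 3 * P ^ 19) := by
          have := hPpow (show 18 ≤ 19 by norm_num)
          gcongr
          norm_num
      _ = _ := one_mul _
  have h2 : 2 * (A : ℝ) ^ 2 * ⌊P ^ 8⌋₊ * (p / 2 ^ B + 22 * B * P ^ 10) ≤ A ^ 3 * P ^ 19 := by
    have hBP : 1 ≤ B * P ^ 10 := one_le_mul_of_one_le_of_one_le hB1 (one_le_pow₀ (by linarith))
    calc _ ≤ 2 * (A : ℝ) ^ 2 * P ^ 8 * (23 * (B * P ^ 10)) := by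
          gcongr
          · exact Nat.floor_le (by positivity)
          · linarith
      _ ≤ 2 * (A : ℝ) ^ 2 * P ^ 8 * (23 * (P / 1000 * P ^ 10)) := by gcongr
      _ = 0.046 * (A ^ 2 * P ^ 19) := by ring
      _ ≤ 1 * (A ^ 3 * P ^ 19) := by
          have := pow_le_pow_right₀ hA1 (show 2 ≤ 3 by norm_num)
          gcongr
          norm_num
      _ = _ := one_mul _
  have h3 : 10 * (A : ℝ) ^ 4 * (p / 2 ^ B) ≤ A ^ 3 * P ^ 19 := by
    calc _ ≤ 10 * (A : ℝ) ^ 4 * 1 := by gcongr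
      _ = 10 * A ^ 3 * A := by ring
      _ ≤ 10 * A ^ 3 * (0.1 * P ^ 2) := by gcongr
      _ = A ^ 3 * P ^ 2 := by ring
      _ ≤ A ^ 3 * P ^ 19 := by
          have := hPpow (show 2 ≤ 19 by norm_num)
          gcongr
  linarith

lemma eventually_log_le_rpow :
    ∀ᶠ p : ℕ in Filter.atTop, 1000 * ((Nat.log 2 p + 1 : ℕ) : ℝ) ≤ (p : ℝ) ^ (0.05 : ℝ) := by
  have h1 := ((isLittleO_log_rpow_atTop (by norm_num : (0 : ℝ) < 0.05)).bound
    (by norm_num : (0 : ℝ) < 1 / 4000))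
  have h2 := (tendsto_rpow_atTop (by norm_num : (0 : ℝ) < 0.05)).eventually_ge_atTop 2000
  filter_upwards [tendsto_natCast_atTop_atTop.eventually h1,
    tendsto_natCast_atTop_atTop.eventually h2, Filter.eventually_ge_atTop 1] with p h1 h2 hp
  have hp1 : (1 : ℝ) ≤ p := by exact_mod_cast hp
  rw [Real.norm_of_nonneg (Real.log_nonneg hp1), Real.norm_of_nonneg (by positivity)] at h1
  have h3 : (Nat.log 2 p : ℝ) ≤ Real.logb 2 p := by exact_mod_cast Real.natLog_le_logb p 2
  have h4 : Real.logb 2 p ≤ 2 * Real.log p := by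
    rw [Real.logb, div_le_iff₀ (Real.log_pos (by norm_num))]
    nlinarith [Real.log_two_gt_d9, Real.log_nonneg hp1]
  push_cast
  linarith

/-- Corollary 4.7: if `M = Ap` with `p` a sufficiently large prime, `gcd(A,p) = 1` and
`A ≤ 0.1 p^0.1`, then `|S(R_M) - 0.25 g_A(1/2) p| ≤ K A³ p^0.95` with `K` absolute. -/
theorem stmt_15 :
    ∃ K : ℝ, 0 < K ∧ ∃ N : ℕ,
      ∀ M A p : ℕ, p.Prime → N ≤ p → Nat.gcd A p = 1 →
        (A : ℝ) ≤ 0.1 * (p : ℝ) ^ (0.1 : ℝ) → M = A * p →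
        |(stoch M (QR M) : ℝ) - 0.25 * gA A (1 / 2) * p| ≤
          K * (A : ℝ) ^ 3 * (p : ℝ) ^ (0.95 : ℝ) := by
  obtain ⟨N, hN⟩ := Filter.eventually_atTop.mp eventually_log_le_rpow
  refine ⟨3, by norm_num, max N 3, ?_⟩
  rintro _ A p hp hNp hAp hA rfl
  have hp3 : 3 ≤ p := (le_max_right _ _).trans hNp
  have hlog := hN p ((le_max_left _ _).trans hNp)
  have : Fact p.Prime := ⟨hp⟩
  have : NeZero A := ⟨by
    rintro rfl
    rw [Nat.gcd_zero_left] at hAp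
    omega⟩
  have hpow : ∀ m : ℕ, ((p : ℝ) ^ (0.05 : ℝ)) ^ m = (p : ℝ) ^ (0.05 * m : ℝ) := fun m => by
    rw [Real.rpow_mul (Nat.cast_nonneg p), Real.rpow_natCast]
  have h19 : (p : ℝ) ^ (0.95 : ℝ) = ((p : ℝ) ^ (0.05 : ℝ)) ^ 19 := by
    rw [hpow]
    norm_num
  have h2 : (p : ℝ) ^ (0.1 : ℝ) = ((p : ℝ) ^ (0.05 : ℝ)) ^ 2 := by
    rw [hpow]
    norm_num
  rw [h19]
  rw [h2] at hA
  refine abs_stoch_QR_sub_le_pow (by omega) hAp (B := Nat.log 2 p + 1) ?_ ?_ hlog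
    (Nat.lt_pow_succ_log_self (by norm_num) p) hA
  · refine le_trans ?_ hlog
    push_cast
    linarith [(Nat.log 2 p).cast_nonneg (α := ℝ)]
  · rw [hpow]
    norm_num
end

section
/- Let A ≥ 3 be an integer, let R_A be the set of quadratic residues modulo A, and for s ∈ {0,1,2} define P_s(y) = Σ_{j=1}^A Σ_{i ∈ R_A ∩ (R_A − j)} j^s·y^{r(i,j)}. Then P_0(y) = |R_A|·Σ_{k=0}^{|R_A|−1} y^k, P_1(y) = A·Σ_{k=0}^{|R_A|−1} (k+1)·y^k, and P_2(y) = Σ_{k=0}^{|R_A|−1} α_k·y^k, where α_k = Σ_{i=1}^{|R_A|} (Σ_{l=i}^{i+k} s_l)² and s_1, ..., s_{|R_A|} are the cyclic consecutive distances between elements of R_A (indices of s taken modulo |R_A|). -/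
open Finset

/-- The coefficients `α_k = Σ_(i=1)^(|R_A|) (s_i + ... + s_(i+k))²` (indices of `s` mod `|R_A|`). -/
def alphaCoef (A k : ℕ) : ℕ :=
  ∑ i ∈ Finset.range (QR A).card, (∑ l ∈ Finset.Icc i (i + k), gapSeq A l) ^ 2

/-- The natural numbers whose class modulo `A` lies in `U`. -/
abbrev residuePred (A : ℕ) (U : Finset (ZMod A)) (x : ℕ) : Prop := (x : ZMod A) ∈ U

/-- The increasing enumeration of the natural numbers whose class modulo `A` lies in `U`. -/
noncomputable def residueNth (A : ℕ) (U : Finset (ZMod A)) : ℕ → ℕ :=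
  Nat.nth (residuePred A U)

lemma residueNth_count {A : ℕ} {U : Finset (ZMod A)} {x : ℕ} (hx : residuePred A U x) :
    residueNth A U (Nat.count (residuePred A U) x) = x :=
  Nat.nth_count hx

section Residues

variable {A : ℕ} [NeZero A] {U : Finset (ZMod A)}

lemma count_residuePred_modulus : Nat.count (residuePred A U) A = U.card := by
  rw [Nat.count_eq_card_filter_range]
  refine Finset.card_bij' (fun x _ => (x : ZMod A)) (fun u _ => u.val) ?_ ?_ ?_ ?_
  · simp
  · intro u hu
    simpa [ZMod.val_lt, residuePred] using hu
  · intro x hx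
    exact ZMod.val_cast_of_lt (by simpa using (Finset.mem_filter.1 hx).1)
  · simp

lemma count_residuePred_add_modulus (x : ℕ) :
    Nat.count (residuePred A U) (x + A) = Nat.count (residuePred A U) x + U.card := by
  rw [add_comm x, Nat.count_add, count_residuePred_modulus, add_comm]
  simp [residuePred]

lemma infinite_residuePred (hU : U.Nonempty) : {x | residuePred A U x}.Infinite := by
  obtain ⟨u, hu⟩ := hU
  refine Set.infinite_of_injective_forall_mem (f := fun k : ℕ => u.val + A * k) ?_ ?_
  · intro a b h
    simpa [NeZero.ne A] using h
  · intro k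
    change ((u.val + A * k : ℕ) : ZMod A) ∈ U
    simpa using hu

lemma residueNth_strictMono (hU : U.Nonempty) : StrictMono (residueNth A U) :=
  Nat.nth_strictMono (infinite_residuePred hU)

lemma residueNth_mem (hU : U.Nonempty) (a : ℕ) : (residueNth A U a : ZMod A) ∈ U :=
  Nat.nth_mem_of_infinite (infinite_residuePred hU) a

lemma count_residueNth (hU : U.Nonempty) (a : ℕ) :
    Nat.count (residuePred A U) (residueNth A U a) = a :=
  Nat.count_nth_of_infinite (infinite_residuePred hU) a

lemma residueNth_add_card (hU : U.Nonempty) (a : ℕ) :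
    residueNth A U (a + U.card) = residueNth A U a + A := by
  have h : residuePred A U (residueNth A U a + A) := by
    simpa [residuePred] using residueNth_mem hU a
  simpa [count_residuePred_add_modulus, count_residueNth hU] using residueNth_count h

lemma residueNth_lt_modulus {a : ℕ} (ha : a < U.card) :
    residueNth A U a < A :=
  Nat.nth_lt_of_lt_count (by rwa [count_residuePred_modulus])

lemma sum_eq_sum_residueNth (hU : U.Nonempty) (f : ZMod A → ℝ) :
    ∑ u ∈ U, f u = ∑ a ∈ Finset.range U.card, f (residueNth A U a) := by
  symm
  refine Finset.sum_bij' (fun a _ => (residueNth A U a : ZMod A))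
    (fun u _ => Nat.count (residuePred A U) u.val) ?_ ?_ ?_ ?_ ?_
  · intro a _
    exact residueNth_mem hU a
  · intro u hu
    rw [Finset.mem_range, ← count_residuePred_modulus (U := U)]
    exact Nat.count_strict_mono (by simpa [residuePred] using hu) u.val_lt
  · intro a ha
    rw [ZMod.val_cast_of_lt (residueNth_lt_modulus (Finset.mem_range.1 ha)),
      count_residueNth hU]
  · intro u hu
    rw [residueNth_count (by simpa [residuePred] using hu), ZMod.natCast_zmod_val]
  · intro a _
    rfl

lemma sum_filter_eq_sum_residueNth (hU : U.Nonempty) (a : ℕ) (f : ℕ → ℝ) :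
    ∑ j ∈ (Finset.Icc 1 A).filter (fun j : ℕ => (residueNth A U a : ZMod A) + j ∈ U), f j =
      ∑ k ∈ Finset.range U.card, f (residueNth A U (a + k + 1) - residueNth A U a) := by
  have hmono := residueNth_strictMono hU
  have hlt (k : ℕ) : residueNth A U a < residueNth A U (a + k + 1) := hmono (by omega)
  symm
  refine Finset.sum_bij' (fun k _ => residueNth A U (a + k + 1) - residueNth A U a)
    (fun j _ => Nat.count (residuePred A U) (residueNth A U a + j) - (a + 1)) ?_ ?_ ?_ ?_ ?_
  · intro k hk
    have h1 := hlt k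
    have h2 : residueNth A U (a + k + 1) ≤ residueNth A U (a + U.card) :=
      hmono.monotone (by have := Finset.mem_range.1 hk; omega)
    rw [residueNth_add_card hU] at h2
    simp only [Finset.mem_filter, Finset.mem_Icc]
    refine ⟨by omega, ?_⟩
    rw [← Nat.cast_add, Nat.add_sub_cancel' h1.le]
    exact residueNth_mem hU _
  · intro j hj
    simp only [Finset.mem_filter, Finset.mem_Icc] at hj
    have h := Nat.count_monotone (residuePred A U)
      (show residueNth A U a + j ≤ residueNth A U a + A by omega)
    rw [count_residuePred_add_modulus, count_residueNth hU] at h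
    have := hU.card_pos
    rw [Finset.mem_range]
    omega
  · intro k _
    simp only [Nat.add_sub_cancel' (hlt k).le, count_residueNth hU]
    omega
  · intro j hj
    simp only [Finset.mem_filter, Finset.mem_Icc] at hj
    have h : Nat.count (residuePred A U) (residueNth A U a) <
        Nat.count (residuePred A U) (residueNth A U a + j) :=
      Nat.count_strict_mono (residueNth_mem hU a) (by omega)
    rw [count_residueNth hU] at h
    have h' : a + (Nat.count (residuePred A U) (residueNth A U a + j) - (a + 1)) + 1 =
        Nat.count (residuePred A U) (residueNth A U a + j) := by omega
    simp only [h']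
    rw [residueNth_count (by simpa [residuePred] using hj.2), Nat.add_sub_cancel_left]
  · intro k _
    rfl

lemma card_filter_Ico_residueNth (hU : U.Nonempty) (a k : ℕ) :
    ((Finset.Ico 1 (residueNth A U (a + k + 1) - residueNth A U a)).filter
      (fun ν : ℕ => (residueNth A U a : ZMod A) + ν ∈ U)).card = k := by
  set j := residueNth A U (a + k + 1) - residueNth A U a with hj
  have hlt : residueNth A U a < residueNth A U (a + k + 1) :=
    residueNth_strictMono hU (by omega)
  have h := Nat.count_add (residuePred A U) (residueNth A U a) j
  rw [hj, Nat.add_sub_cancel' hlt.le, ← hj, count_residueNth hU, count_residueNth hU,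
    Nat.count_eq_card_filter_range, Finset.range_eq_Ico,
    ← Finset.insert_Ico_add_one_left_eq_Ico (show 0 < j by omega), Finset.filter_insert,
    if_pos (by simpa [residuePred] using residueNth_mem hU a),
    Finset.card_insert_of_notMem (by simp)] at h
  simp only [residuePred, Nat.cast_add, zero_add] at h
  omega

lemma sum_residueNth_sub (hU : U.Nonempty) (k : ℕ) :
    ∑ a ∈ Finset.range U.card, ((residueNth A U (a + k) : ℝ) - residueNth A U a) = A * k := by
  induction k with
  | zero => simp
  | succ k ih =>
    have h := Finset.sum_range_sub (fun a => (residueNth A U (a + k) : ℝ)) U.card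
    have h' := residueNth_add_card hU k
    rw [add_comm] at h'
    simp only [h', zero_add, Nat.cast_add, add_sub_cancel_left] at h
    rw [Nat.cast_add, Nat.cast_one, mul_add, mul_one, ← ih, ← h, ← Finset.sum_add_distrib]
    refine Finset.sum_congr rfl fun a _ => ?_
    rw [show a + (k + 1) = a + 1 + k by ring]
    ring

end Residues

lemma one_lt_card_QR {A : ℕ} (hA : 3 ≤ A) : 1 < (QR A).card := by
  have : Fact (1 < A) := ⟨by omega⟩
  refine Finset.one_lt_card.2 ⟨0, ?_, 1, ?_, zero_ne_one⟩
  · exact Finset.mem_image.2 ⟨0, by simp; omega, by simp⟩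
  · exact Finset.mem_image.2 ⟨1, by simp; omega, by simp⟩

section QuadraticResidues

variable {A : ℕ} [NeZero A]

lemma QR_nonempty : (QR A).Nonempty :=
  (Finset.nonempty_range_iff.2 (NeZero.ne A)).image _

lemma resList_eq_map_residueNth :
    resList A = (List.range (QR A).card).map (residueNth A (QR A)) := by
  have hmono := residueNth_strictMono (QR_nonempty (A := A))
  have himage : (QR A).image ZMod.val =
      (Finset.range (QR A).card).image (residueNth A (QR A)) := by
    ext x
    simp only [Finset.mem_image, Finset.mem_range]
    constructor
    · rintro ⟨u, hu, rfl⟩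
      have hp : residuePred A (QR A) u.val := by simpa [residuePred] using hu
      refine ⟨_, ?_, residueNth_count hp⟩
      rw [← count_residuePred_modulus (U := QR A)]
      exact Nat.count_strict_mono hp u.val_lt
    · rintro ⟨a, ha, rfl⟩
      exact ⟨_, residueNth_mem QR_nonempty a,
        ZMod.val_cast_of_lt (residueNth_lt_modulus ha)⟩
  have hsorted : ((List.range (QR A).card).map (residueNth A (QR A))).Pairwise (· < ·) :=
    List.pairwise_map.2 (List.pairwise_lt_range.imp fun h => hmono h)
  rw [resList, himage]
  refine List.Perm.eq_of_pairwise' (r := (· ≤ ·)) (Finset.pairwise_sort _ _)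
    (hsorted.imp le_of_lt) ?_
  refine (List.perm_ext_iff_of_nodup (Finset.sort_nodup _ _) (hsorted.imp ne_of_lt)).2 ?_
  simp

lemma residueNth_QR_add_gapSeq (hA : 3 ≤ A) (i : ℕ) :
    residueNth A (QR A) i + gapSeq A i = residueNth A (QR A) (i + 1) := by
  have hU := QR_nonempty (A := A)
  have hmono := residueNth_strictMono hU
  have hcard := one_lt_card_QR hA
  set n := (QR A).card with hn
  have hget (m : ℕ) (hm : m < n) : (resList A).getD m 0 = residueNth A (QR A) m := by
    rw [resList_eq_map_residueNth, List.getD_eq_getElem _ _ (by simpa using hm)]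
    simp
  have hlen : (resList A).length = n := by simp [resList_eq_map_residueNth, hn]
  have hperiod (m q : ℕ) : residueNth A (QR A) (m + n * q) = residueNth A (QR A) m + A * q := by
    induction q with
    | zero => simp
    | succ q ih => rw [mul_add, mul_one, ← add_assoc, residueNth_add_card hU, ih]; ring
  have hmod : i % n < n := Nat.mod_lt _ (by omega)
  have hi := hperiod (i % n) (i / n)
  have hi' := hperiod (i % n + 1) (i / n)
  rw [Nat.mod_add_div] at hi
  rw [show i % n + 1 + n * (i / n) = i + 1 by have := Nat.mod_add_div i n; omega] at hi'
  suffices h : gapSeq A i =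
      residueNth A (QR A) (i % n + 1) - residueNth A (QR A) (i % n) by
    have := hmono (Nat.lt_add_one (i % n))
    omega
  have hlt := hmono (Nat.lt_add_one (i % n))
  simp only [gapSeq, hlen]
  rw [hget _ hmod, hget _ (Nat.mod_lt _ (by omega))]
  rcases Nat.lt_or_ge (i % n + 1) n with h | h
  · have hA' := residueNth_lt_modulus h
    rw [show (i + 1) % n = i % n + 1 by
      rw [Nat.add_mod, Nat.mod_eq_of_lt hcard, Nat.mod_eq_of_lt h]]
    rw [show ∀ x y : ℕ, y < x → x + A - y = x - y + A by omega, Nat.add_mod_right,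
      Nat.mod_eq_of_lt (by omega)]
    exact hlt
  · have hlast : i % n + 1 = n := by omega
    have h0 := hmono (show 0 < i % n by omega)
    have hA' := residueNth_lt_modulus hmod
    rw [show (i + 1) % n = 0 by
      rw [Nat.add_mod, Nat.mod_eq_of_lt hcard, hlast, Nat.mod_self]]
    have hwrap := residueNth_add_card hU 0
    rw [zero_add, ← hn] at hwrap
    rw [hlast, hwrap, Nat.mod_eq_of_lt (by omega)]

lemma residueNth_QR_add_sum_gapSeq (hA : 3 ≤ A) (i k : ℕ) :
    residueNth A (QR A) i + ∑ l ∈ Finset.Icc i (i + k), gapSeq A l =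
      residueNth A (QR A) (i + k + 1) := by
  induction k with
  | zero => simpa using residueNth_QR_add_gapSeq hA i
  | succ k ih =>
    rw [← add_assoc, Finset.sum_Icc_succ_top (by omega), ← add_assoc, ih,
      residueNth_QR_add_gapSeq hA]

/-- Pairs of residues at cyclic distance `j` are enumerated by a residue and the number of
residues strictly between the two. -/
lemma sum_rij_eq_sum_residueNth (f : ℕ → ℝ) (y : ℝ) :
    (∑ j ∈ Finset.Icc 1 A, ∑ i ∈ (QR A).filter (fun i => i + (j : ZMod A) ∈ QR A),
        f j * y ^ (rij A i j)) =
      ∑ k ∈ Finset.range (QR A).card, (∑ a ∈ Finset.range (QR A).card,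
        f (residueNth A (QR A) (a + k + 1) - residueNth A (QR A) a)) * y ^ k := by
  have hU := QR_nonempty (A := A)
  simp only [Finset.sum_filter]
  rw [Finset.sum_comm, sum_eq_sum_residueNth hU]
  simp only [Finset.sum_mul]
  refine Eq.trans ?_ Finset.sum_comm
  refine Finset.sum_congr rfl fun a _ => ?_
  rw [← Finset.sum_filter, sum_filter_eq_sum_residueNth hU]
  refine Finset.sum_congr rfl fun k _ => ?_
  rw [rij, card_filter_Ico_residueNth hU]

end QuadraticResidues

/-- Lemma 5.2: with `P_s(y) = Σ_(j=1)^A Σ_(i ∈ R_A ∩ (R_A - j)) j^s y^(r(i,j))`, one has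
`P_0(y) = |R_A| Σ_(k<|R_A|) y^k`, `P_1(y) = A Σ_(k<|R_A|) (k+1) y^k`, and
`P_2(y) = Σ_(k<|R_A|) α_k y^k`. -/
theorem stmt_16 (A : ℕ) (hA : 3 ≤ A) (y : ℝ) :
    (∑ j ∈ Finset.Icc 1 A, ∑ i ∈ (QR A).filter (fun i => i + (j : ZMod A) ∈ QR A),
        y ^ (rij A i j)) = (QR A).card * ∑ k ∈ Finset.range (QR A).card, y ^ k ∧
    (∑ j ∈ Finset.Icc 1 A, ∑ i ∈ (QR A).filter (fun i => i + (j : ZMod A) ∈ QR A),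
        (j : ℝ) * y ^ (rij A i j)) =
      (A : ℝ) * ∑ k ∈ Finset.range (QR A).card, (k + 1 : ℝ) * y ^ k ∧
    (∑ j ∈ Finset.Icc 1 A, ∑ i ∈ (QR A).filter (fun i => i + (j : ZMod A) ∈ QR A),
        (j : ℝ) ^ 2 * y ^ (rij A i j)) =
      ∑ k ∈ Finset.range (QR A).card, (alphaCoef A k : ℝ) * y ^ k := by
  have : NeZero A := ⟨by omega⟩
  have hU := QR_nonempty (A := A)
  refine ⟨?_, ?_, ?_⟩
  · have h := sum_rij_eq_sum_residueNth (A := A) (fun _ => 1) y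
    simp only [one_mul] at h
    rw [h, Finset.mul_sum]
    simp
  · rw [sum_rij_eq_sum_residueNth (A := A) (fun j => (j : ℝ)) y, Finset.mul_sum]
    refine Finset.sum_congr rfl fun k _ => ?_
    rw [← mul_assoc]
    congr 1
    rw [← Nat.cast_add_one, ← sum_residueNth_sub hU]
    refine Finset.sum_congr rfl fun a _ => ?_
    rw [Nat.cast_sub ((residueNth_strictMono hU).monotone (by omega)), add_assoc]
  · rw [sum_rij_eq_sum_residueNth (A := A) (fun j => (j : ℝ) ^ 2) y]
    refine Finset.sum_congr rfl fun k _ => ?_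
    congr 1
    rw [alphaCoef, Nat.cast_sum]
    refine Finset.sum_congr rfl fun a _ => ?_
    rw [← residueNth_QR_add_sum_gapSeq hA, Nat.add_sub_cancel_left, Nat.cast_pow]
end

section
/- There is an absolute constant K > 0 such that for every integer A ≥ 3 and every positive integer t with |R_A| ≤ 2^t, the second derivative of f_A satisfies |f_A''(y)| ≤ K·A²·|R_A| for all y ∈ (1 − 2^{−t}, 1). -/
open Finset

theorem length_resList {A : ℕ} (hA : 3 ≤ A) : (resList A).length = (QR A).card := by
  have : NeZero A := ⟨by omega⟩
  rw [resList, Finset.length_sort, Finset.card_image_of_injective _ (ZMod.val_injective A)]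

theorem getD_resList_le {A : ℕ} (hA : 3 ≤ A) (i : ℕ) : (resList A).getD i 0 ≤ A := by
  have : NeZero A := ⟨by omega⟩
  by_cases hi : i < (resList A).length
  · rw [List.getD_eq_getElem _ _ hi]
    obtain ⟨x, -, hx⟩ := Finset.mem_image.mp ((Finset.mem_sort _).mp (List.getElem_mem hi))
    exact hx.symm.trans_le (ZMod.val_lt x).le
  · rw [List.getD_eq_default _ _ (by omega)]
    omega

theorem getD_resList_le_succ {A i : ℕ} (hi : i + 1 < (resList A).length) :
    (resList A).getD i 0 ≤ (resList A).getD (i + 1) 0 := by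
  rw [List.getD_eq_getElem _ _ hi, List.getD_eq_getElem _ _ (by omega)]
  have hsorted : (resList A).Pairwise (· ≤ ·) := Finset.pairwise_sort _ _
  exact List.pairwise_iff_getElem.mp hsorted i (i + 1) (by omega) hi (by omega)

theorem gapSeq_periodic {A : ℕ} (hA : 3 ≤ A) (i : ℕ) :
    gapSeq A (i + (QR A).card) = gapSeq A i := by
  simp only [gapSeq, length_resList hA, Nat.add_mod_right, add_right_comm i _ 1]

/-- The gaps between quadratic residues sum to at most `A`. -/
theorem sum_gapSeq_le {A : ℕ} (hA : 3 ≤ A) :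
    ∑ i ∈ range (QR A).card, gapSeq A i ≤ A := by
  rcases hn : (QR A).card with _ | m
  · simp
  have hl : (resList A).length = m + 1 := by rw [length_resList hA, hn]
  have hpart : ∀ j ≤ m, ∑ i ∈ range j, gapSeq A i + (resList A).getD 0 0
      ≤ (resList A).getD j 0 := by
    intro j
    induction j with
    | zero => simp
    | succ j ih =>
      intro hj
      have h1 := ih (by omega)
      have h2 := getD_resList_le_succ (A := A) (i := j) (by omega)
      have h3 : gapSeq A j ≤ (resList A).getD (j + 1) 0 - (resList A).getD j 0 := by
        simp only [gapSeq, hl]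
        rw [Nat.mod_eq_of_lt (show j + 1 < m + 1 by omega),
          Nat.mod_eq_of_lt (show j < m + 1 by omega),
          show (resList A).getD (j + 1) 0 + A - (resList A).getD j 0
            = (resList A).getD (j + 1) 0 - (resList A).getD j 0 + A by omega,
          Nat.add_mod_right]
        exact Nat.mod_le _ _
      rw [sum_range_succ]
      omega
  have h1 := hpart m le_rfl
  have h2 : gapSeq A m ≤ (resList A).getD 0 0 + A - (resList A).getD m 0 := by
    simp only [gapSeq, hl]
    rw [Nat.mod_self, Nat.mod_eq_of_lt (show m < m + 1 by omega)]
    exact Nat.mod_le _ _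
  have h3 := getD_resList_le hA m
  rw [sum_range_succ]
  omega

theorem sum_gapSeq_shift {A : ℕ} (hA : 3 ≤ A) (i : ℕ) :
    ∑ k ∈ range (QR A).card, gapSeq A (i + k) = ∑ k ∈ range (QR A).card, gapSeq A k := by
  induction i with
  | zero => simp
  | succ i ih =>
    rw [← ih]
    have h1 := sum_range_succ (fun k => gapSeq A (i + k)) (QR A).card
    rw [sum_range_succ', gapSeq_periodic hA] at h1
    simpa [add_assoc, add_comm 1] using h1

theorem betaCoef_le {A : ℕ} (hA : 3 ≤ A) (k : ℕ) :
    betaCoef A k ≤ 2 * ∑ i ∈ range (QR A).card, gapSeq A i * gapSeq A (i + k) := by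
  rw [betaCoef]
  split_ifs with h
  · have : ∀ i, gapSeq A (i + k) = gapSeq A i := by
      rcases h with rfl | rfl
      · simp
      · exact gapSeq_periodic hA
    simp only [this, sq]
    omega
  · exact le_rfl

theorem sum_betaCoef_le {A : ℕ} (hA : 3 ≤ A) :
    ∑ k ∈ range ((QR A).card + 1), betaCoef A k ≤ 4 * A ^ 2 := by
  have hS := sum_gapSeq_le hA
  have hgap : ∀ i ∈ range (QR A).card, gapSeq A i ≤ A := fun i hi =>
    (single_le_sum (f := gapSeq A) (fun _ _ => Nat.zero_le _) hi).trans hS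
  calc ∑ k ∈ range ((QR A).card + 1), betaCoef A k
      ≤ ∑ k ∈ range ((QR A).card + 1),
          2 * ∑ i ∈ range (QR A).card, gapSeq A i * gapSeq A (i + k) :=
        sum_le_sum fun k _ => betaCoef_le hA k
    _ = 2 * ∑ i ∈ range (QR A).card,
          gapSeq A i * ∑ k ∈ range ((QR A).card + 1), gapSeq A (i + k) := by
        rw [← mul_sum, sum_comm]
        simp only [mul_sum]
    _ ≤ 2 * ∑ i ∈ range (QR A).card, gapSeq A i * (A + A) := by
        gcongr with i hi
        rw [sum_range_succ, sum_gapSeq_shift hA, gapSeq_periodic hA]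
        exact add_le_add hS (hgap i hi)
    _ ≤ 2 * (A * (A + A)) := by
        rw [← sum_mul]
        gcongr
    _ = 4 * A ^ 2 := by ring

theorem hasDerivAt_sum_mul_pow (s : Finset ℕ) (b : ℕ → ℝ) (e : ℕ → ℕ) (y : ℝ) :
    HasDerivAt (fun y => ∑ k ∈ s, b k * y ^ e k) (∑ k ∈ s, b k * e k * y ^ (e k - 1)) y := by
  refine HasDerivAt.fun_sum fun k _ => ?_
  simpa [mul_assoc] using (hasDerivAt_pow (e k) y).const_mul (b k)

theorem sum_mul_mul_pow_mem_Icc {s : Finset ℕ} {b c : ℕ → ℝ} {e : ℕ → ℕ} {y B C : ℝ}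
    (hb : ∀ k, 0 ≤ b k) (hB : ∑ k ∈ s, b k ≤ B) (hc : ∀ k ∈ s, 0 ≤ c k)
    (hcC : ∀ k ∈ s, c k ≤ C) (hC : 0 ≤ C) (hy0 : 0 ≤ y) (hy1 : y ≤ 1) :
    ∑ k ∈ s, b k * c k * y ^ e k ∈ Set.Icc 0 (B * C) := by
  refine ⟨sum_nonneg fun k hk => mul_nonneg (mul_nonneg (hb k) (hc k hk)) (by positivity), ?_⟩
  calc ∑ k ∈ s, b k * c k * y ^ e k ≤ ∑ k ∈ s, b k * C := by
        refine sum_le_sum fun k hk => ?_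
        have h := mul_le_mul_of_nonneg_left (hcC k hk) (hb k)
        exact (mul_le_of_le_one_right (mul_nonneg (hb k) (hc k hk))
          (pow_le_one₀ hy0 hy1)).trans h
    _ = (∑ k ∈ s, b k) * C := by rw [sum_mul]
    _ ≤ B * C := mul_le_mul_of_nonneg_right hB hC

/-- A power sum with nonnegative coefficients and degree at most `n` is twice differentiable, and
its derivatives on `[0, 1]` are controlled by `n` and the sum of the coefficients. -/
theorem exists_derivs_sum_mul_pow {s : Finset ℕ} {b : ℕ → ℝ} {n : ℕ} {B : ℝ}
    (hb : ∀ k, 0 ≤ b k) (hB : ∑ k ∈ s, b k ≤ B) (hs : ∀ k ∈ s, k ≤ n) :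
    ∃ D₁ D₂ : ℝ → ℝ,
      (∀ y, HasDerivAt (fun y => ∑ k ∈ s, b k * y ^ k) (D₁ y) y) ∧
      (∀ y, HasDerivAt D₁ (D₂ y) y) ∧
      ∀ y, 0 ≤ y → y ≤ 1 → ∑ k ∈ s, b k * y ^ k ∈ Set.Icc 0 B ∧
        D₁ y ∈ Set.Icc 0 (B * n) ∧ D₂ y ∈ Set.Icc 0 (B * n ^ 2) := by
  refine ⟨fun y => ∑ k ∈ s, b k * k * y ^ (k - 1),
    fun y => ∑ k ∈ s, b k * k * (k - 1 : ℕ) * y ^ (k - 1 - 1),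
    fun y => hasDerivAt_sum_mul_pow s b (fun k => k) y,
    fun y => hasDerivAt_sum_mul_pow s (fun k => b k * k) (fun k => k - 1) y,
    fun y hy0 hy1 => ⟨?_, ?_, ?_⟩⟩
  · simpa using sum_mul_mul_pow_mem_Icc (c := fun _ => 1) (e := fun k => k) hb hB
      (fun _ _ => zero_le_one) (fun _ _ => le_rfl) zero_le_one hy0 hy1
  · exact sum_mul_mul_pow_mem_Icc (c := fun k => k) (e := fun k => k - 1) hb hB
      (fun _ _ => by positivity) (fun k hk => by exact_mod_cast hs k hk) (by positivity) hy0 hy1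
  · have h := sum_mul_mul_pow_mem_Icc (c := fun k => (k : ℝ) * (k - 1 : ℕ)) (C := (n : ℝ) ^ 2)
      (e := fun k => k - 1 - 1) hb hB
      (fun _ _ => by positivity) (fun k hk => ?_) (by positivity) hy0 hy1
    · simpa only [mul_assoc] using h
    · have h1 := hs k hk
      rw [sq]
      gcongr
      omega

/-- The quotient rule for second derivatives. -/
theorem iteratedDeriv_two_div {F F₁ F₂ Q Q₁ Q₂ : ℝ → ℝ} {y : ℝ}
    (hF : ∀ x, HasDerivAt F (F₁ x) x) (hF₁ : ∀ x, HasDerivAt F₁ (F₂ x) x)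
    (hQ : ∀ x, HasDerivAt Q (Q₁ x) x) (hQ₁ : ∀ x, HasDerivAt Q₁ (Q₂ x) x) (hy : Q y ≠ 0) :
    iteratedDeriv 2 (fun x => F x / Q x) y =
      F₂ y / Q y - 2 * F₁ y * Q₁ y / Q y ^ 2 - F y * Q₂ y / Q y ^ 2
        + 2 * F y * Q₁ y ^ 2 / Q y ^ 3 := by
  rw [iteratedDeriv_succ, iteratedDeriv_one]
  have hev : deriv (fun x => F x / Q x) =ᶠ[nhds y]
      fun x => (F₁ x * Q x - F x * Q₁ x) / Q x ^ 2 := by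
    filter_upwards [(hQ y).continuousAt.eventually_ne hy] with x hx
    exact ((hF x).fun_div (hQ x) hx).deriv
  rw [hev.deriv_eq, ((((hF₁ y).fun_mul (hQ y)).fun_sub ((hF y).fun_mul (hQ₁ y))).fun_div
    ((hQ y).fun_pow 2) (pow_ne_zero 2 hy)).deriv]
  field_simp
  ring

theorem abs_second_deriv_quotient_le {F F₁ F₂ Q Q₁ Q₂ B n : ℝ} (hn : 0 < n)
    (hF : F ∈ Set.Icc 0 B) (hF₁ : F₁ ∈ Set.Icc 0 (B * n)) (hF₂ : F₂ ∈ Set.Icc 0 (B * n ^ 2))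
    (hQ : n / 2 ≤ Q) (hQ₁ : Q₁ ∈ Set.Icc 0 (n * n)) (hQ₂ : Q₂ ∈ Set.Icc 0 (n * n ^ 2)) :
    |F₂ / Q - 2 * F₁ * Q₁ / Q ^ 2 - F * Q₂ / Q ^ 2 + 2 * F * Q₁ ^ 2 / Q ^ 3| ≤ 30 * B * n := by
  obtain ⟨hF0, hFB⟩ := hF
  obtain ⟨hF₁0, hF₁B⟩ := hF₁
  obtain ⟨hF₂0, hF₂B⟩ := hF₂
  obtain ⟨hQ₁0, hQ₁n⟩ := hQ₁
  obtain ⟨hQ₂0, hQ₂n⟩ := hQ₂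
  have hQ0 : 0 < Q := by linarith
  have hB : 0 ≤ B := hF0.trans hFB
  have h1 : F₂ / Q ≤ 2 * B * n := calc
    F₂ / Q ≤ B * n ^ 2 / (n / 2) := by gcongr
    _ = 2 * B * n := by field_simp
  have h2 : 2 * F₁ * Q₁ / Q ^ 2 ≤ 8 * B * n := calc
    2 * F₁ * Q₁ / Q ^ 2 ≤ 2 * (B * n) * (n * n) / (n / 2) ^ 2 := by gcongr
    _ = 8 * B * n := by field_simp; ring
  have h3 : F * Q₂ / Q ^ 2 ≤ 4 * B * n := calc
    F * Q₂ / Q ^ 2 ≤ B * (n * n ^ 2) / (n / 2) ^ 2 := by gcongr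
    _ = 4 * B * n := by field_simp; ring
  have h4 : 2 * F * Q₁ ^ 2 / Q ^ 3 ≤ 16 * B * n := calc
    2 * F * Q₁ ^ 2 / Q ^ 3 ≤ 2 * B * (n * n) ^ 2 / (n / 2) ^ 3 := by gcongr
    _ = 16 * B * n := by field_simp; ring
  have h1' : 0 ≤ F₂ / Q := by positivity
  have h2' : 0 ≤ 2 * F₁ * Q₁ / Q ^ 2 := by positivity
  have h3' : 0 ≤ F * Q₂ / Q ^ 2 := by positivity
  have h4' : 0 ≤ 2 * F * Q₁ ^ 2 / Q ^ 3 := by positivity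
  have hBn : 0 ≤ B * n := by positivity
  rw [abs_le]
  constructor <;> linarith

theorem half_le_geom_sum {n : ℕ} {y : ℝ} (hy0 : 0 ≤ y) (hy : n * (1 - y) ≤ 1) (hy1 : y ≤ 1) :
    (n : ℝ) / 2 ≤ ∑ k ∈ range n, y ^ k := by
  have hlin : ∀ m : ℕ, (m : ℝ) - m * (m - 1) / 2 * (1 - y) ≤ ∑ k ∈ range m, y ^ k := by
    intro m
    induction m with
    | zero => simp
    | succ m ih =>
      have hb := one_add_mul_le_pow (a := y - 1) (by linarith) m
      rw [add_sub_cancel] at hb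
      rw [sum_range_succ]
      push_cast
      linarith
  have h := hlin n
  have hn : (0 : ℝ) ≤ n := Nat.cast_nonneg n
  nlinarith [mul_le_mul_of_nonneg_left hy hn, mul_nonneg hn (sub_nonneg.mpr hy1)]

/-- Lemma 5.4: if `|R_A| ≤ 2^t`, then `|f_A''(y)| ≤ K A² |R_A|` for `y ∈ (1 - 2^(-t), 1)`,
with an absolute constant `K`. -/
theorem stmt_18 :
    ∃ K : ℝ, 0 < K ∧
      ∀ A t : ℕ, 3 ≤ A → 0 < t → (QR A).card ≤ 2 ^ t →
        ∀ y : ℝ, 1 - (2 : ℝ) ^ (-(t : ℤ)) < y → y < 1 →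
          |iteratedDeriv 2 (fA A) y| ≤ K * (A : ℝ) ^ 2 * ((QR A).card : ℝ) := by
  refine ⟨120, by norm_num, fun A t hA _ hcard y hy hy1 => ?_⟩
  have hpos : 0 < (QR A).card :=
    card_pos.mpr ⟨((0 : ℕ) : ZMod A) ^ 2, mem_image_of_mem _ (mem_range.mpr (by omega))⟩
  have hcard' : ((QR A).card : ℝ) ≤ 2 ^ t := by exact_mod_cast hcard
  have hn : (0 : ℝ) < (QR A).card := by exact_mod_cast hpos
  rw [zpow_neg, zpow_natCast] at hy
  have hpow : (2 : ℝ) ^ t * (2 ^ t)⁻¹ = 1 := mul_inv_cancel₀ (by positivity)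
  have hyn : (QR A).card * (1 - y) ≤ 1 := by
    rw [← hpow]
    exact mul_le_mul hcard' (by linarith) (by linarith) (by positivity)
  have hy0 : 0 ≤ y := by
    have : ((2 : ℝ) ^ t)⁻¹ ≤ 1 := inv_le_one_of_one_le₀ (one_le_pow₀ (by norm_num))
    linarith
  have hB : ∑ k ∈ range ((QR A).card + 1), (betaCoef A k : ℝ) ≤ 4 * (A : ℝ) ^ 2 := by
    exact_mod_cast sum_betaCoef_le hA
  obtain ⟨F₁, F₂, hF, hF₁, hFb⟩ := exists_derivs_sum_mul_pow (n := (QR A).card)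
    (fun k => Nat.cast_nonneg (betaCoef A k)) hB
    (fun k hk => Nat.lt_succ_iff.mp (mem_range.mp hk))
  obtain ⟨Q₁, Q₂, hQ, hQ₁, hQb⟩ := exists_derivs_sum_mul_pow (s := range (QR A).card)
    (b := fun _ => 1) (n := (QR A).card) (B := (QR A).card) (fun _ => zero_le_one) (by simp)
    (fun k hk => (mem_range.mp hk).le)
  simp only [one_mul] at hQ hQb
  have hQy := half_le_geom_sum hy0 hyn hy1.le
  obtain ⟨hFy, hF₁y, hF₂y⟩ := hFb y hy0 hy1.le
  obtain ⟨-, hQ₁y, hQ₂y⟩ := hQb y hy0 hy1.le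
  have hbound := abs_second_deriv_quotient_le hn hFy hF₁y hF₂y hQy hQ₁y hQ₂y
  rw [← iteratedDeriv_two_div hF hF₁ hQ hQ₁ (by linarith)] at hbound
  calc |iteratedDeriv 2 (fA A) y| ≤ 30 * (4 * (A : ℝ) ^ 2) * (QR A).card := hbound
    _ = 120 * (A : ℝ) ^ 2 * (QR A).card := by ring
end
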